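/- arXiv:2311.09397 — 7 statements merged into one kernel-verified Lean document; each statement's English description precedes it below -/
import Mathlib

section
/- Topological pressure of a correspondence equals the pressure of the induced shift: Let T be a correspondence on a compact metric space (X,d), φ : O₂(T) → ℝ a continuous function, σ the shift map on the orbit space (O_ω(T), d_ω), and φ̃ : O_ω(T) → ℝ the lift of φ. Then P(T,φ) = P(σ, φ̃), where P(σ, φ̃) is the classical topological pressure of the continuous map σ on the compact metric space (O_ω(T), d_ω) with potential φ̃. -/
open Filter MeasureTheory Set
open scoped Topology ENNReal Classical

namespace Corr

variable {X : Type*}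

/-- `T` is a correspondence on `X`: each `T x` is a nonempty closed subset of `X`
and the graph `O₂(T)` is closed in `X × X`. -/
def IsCorrespondence [MetricSpace X] (T : X → Set X) : Prop :=
  (∀ x, (T x).Nonempty) ∧ (∀ x, IsClosed (T x)) ∧ IsClosed {p : X × X | p.2 ∈ T p.1}

/-- The graph `O₂(T) = {(x₁,x₂) : x₂ ∈ T x₁}`. -/
def graph2 (T : X → Set X) : Set (X × X) := {p | p.2 ∈ T p.1}

/-- The orbit space `O_ω(T)` (0-indexed sequences). -/
def orbitSpace (T : X → Set X) : Set (ℕ → X) := {x | ∀ k, x (k + 1) ∈ T (x k)}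

/-- `x : Fin (n+1) → X` is an element of `O_{n+1}(T)`. -/
def IsFinOrbit (T : X → Set X) {n : ℕ} (x : Fin (n + 1) → X) : Prop :=
  ∀ i : Fin n, x i.succ ∈ T (x i.castSucc)

/-- `O_{n+1}(T)` as a subset of `Fin (n+1) → X` (with the sup metric). -/
def finOrbits (T : X → Set X) (n : ℕ) : Set (Fin (n + 1) → X) := {x | IsFinOrbit T x}

/-- The first `n` entries of `x : ℕ → X` form an orbit in `O_n(T)`. -/
def IsOrbitSeg (T : X → Set X) (n : ℕ) (x : ℕ → X) : Prop :=
  ∀ i : ℕ, i + 1 < n → x (i + 1) ∈ T (x i)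

/-- The shift on sequences. -/
def shiftSeq : (ℕ → X) → ℕ → X := fun x k => x (k + 1)

/-- The shift `σ` on the orbit space `O_ω(T)`. -/
def shiftOrb (T : X → Set X) : ↥(orbitSpace T) → ↥(orbitSpace T) :=
  fun x => ⟨shiftSeq x.1, fun k => x.2 (k + 1)⟩

/-- The metric `d_ω` on sequences (`k`-th coordinate, `k ≥ 0`, has weight `2^{-(k+1)}`). -/
noncomputable def dOmega [MetricSpace X] (x y : ℕ → X) : ℝ :=
  ∑' k : ℕ, (1 / 2 : ℝ) ^ (k + 1) * (dist (x k) (y k) / (1 + dist (x k) (y k)))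

/-- `T` is forward expansive with expansive constant `ε`. -/
def IsFwdExpansiveWith [MetricSpace X] (T : X → Set X) (ε : ℝ) : Prop :=
  0 < ε ∧ ∀ x ∈ orbitSpace T, ∀ y ∈ orbitSpace T, x ≠ y → ∃ n : ℕ, ε < dist (x n) (y n)

/-- `T` is forward expansive. -/
def IsFwdExpansive [MetricSpace X] (T : X → Set X) : Prop :=
  ∃ ε : ℝ, IsFwdExpansiveWith T ε

/-- Extension by `0` of a potential `φ : O₂(T) → ℝ` to `X × X`. -/
noncomputable def ext2 (T : X → Set X) (φ : ↥(graph2 T) → ℝ) : X × X → ℝ :=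
  fun p => if h : p ∈ graph2 T then φ ⟨p, h⟩ else 0

/-- The Birkhoff sum `S_n φ` along an element of `X^{n+1}` (equal to the sum
`∑_{i=1}^n φ(x_i, x_{i+1})` on orbits in `O_{n+1}(T)`). -/
noncomputable def birkhoff (T : X → Set X) (φ : ↥(graph2 T) → ℝ) {n : ℕ}
    (x : Fin (n + 1) → X) : ℝ :=
  ∑ i : Fin n, ext2 T φ (x i.castSucc, x i.succ)

/-- `E` is `ε`-separated: distinct points of `E` are at distance `≥ ε`. -/
def eSep {Y : Type*} [PseudoMetricSpace Y] (ε : ℝ) (E : Set Y) : Prop :=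
  ∀ x ∈ E, ∀ y ∈ E, x ≠ y → ε ≤ dist x y

/-- `∑_{x ∈ E} exp (S_n φ (x))` for a set `E` of orbit segments. -/
noncomputable def orbSum (T : X → Set X) (φ : ↥(graph2 T) → ℝ) (n : ℕ)
    (E : Set (Fin (n + 1) → X)) : ℝ≥0∞ :=
  ∑' x : E, ENNReal.ofReal (Real.exp (birkhoff T φ (x : Fin (n + 1) → X)))

/-- Logarithm `ℝ≥0∞ → EReal`, with `log 0 = ⊥` and `log ⊤ = ⊤`. -/
noncomputable def elog (x : ℝ≥0∞) : EReal :=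
  if x = 0 then ⊥ else if x = ⊤ then ⊤ else ((Real.log x.toReal : ℝ) : EReal)

/-- `sup_E ∑_{x ∈ E} exp (S_n φ (x))` over `ε`-separated subsets `E` of `O_{n+1}(T)`. -/
noncomputable def sepSup [MetricSpace X] (T : X → Set X) (φ : ↥(graph2 T) → ℝ)
    (n : ℕ) (ε : ℝ) : ℝ≥0∞ :=
  ⨆ (E : Set (Fin (n + 1) → X)) (_ : E ⊆ finOrbits T n) (_ : eSep ε E), orbSum T φ n E

/-- `inf_F ∑_{x ∈ F} exp (S_n φ (x))` over `ε`-spanning subsets `F` of `O_{n+1}(T)`. -/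
noncomputable def spanInf [MetricSpace X] (T : X → Set X) (φ : ↥(graph2 T) → ℝ)
    (n : ℕ) (ε : ℝ) : ℝ≥0∞ :=
  ⨅ (E : Set (Fin (n + 1) → X)) (_ : E ⊆ finOrbits T n)
    (_ : ∀ y ∈ finOrbits T n, ∃ x ∈ E, dist x y < ε), orbSum T φ n E

/-- `limsup_n (1/n) log sup_E ∑_{x ∈ E} exp (S_n φ (x))` for a fixed `ε`. -/
noncomputable def pressSepEps [MetricSpace X] (T : X → Set X) (φ : ↥(graph2 T) → ℝ)
    (ε : ℝ) : EReal :=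
  Filter.limsup (fun n : ℕ => (((n : ℝ)⁻¹ : ℝ) : EReal) * elog (sepSup T φ n ε)) atTop

/-- The spanning-set analogue of `pressSepEps`. -/
noncomputable def pressSpanEps [MetricSpace X] (T : X → Set X) (φ : ↥(graph2 T) → ℝ)
    (ε : ℝ) : EReal :=
  Filter.limsup (fun n : ℕ => (((n : ℝ)⁻¹ : ℝ) : EReal) * elog (spanInf T φ n ε)) atTop

/-- The topological pressure `P(T,φ)` of a correspondence: the limit as `ε → 0⁺`
(equivalently, since `pressSepEps` is antitone in `ε`, the limsup) of
`limsup_n (1/n) log sup_E ∑_{x∈E} exp (S_nφ(x))` over `ε`-separated sets `E ⊆ O_{n+1}(T)`. -/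
noncomputable def pressure [MetricSpace X] (T : X → Set X) (φ : ↥(graph2 T) → ℝ) : EReal :=
  Filter.limsup (fun ε : ℝ => pressSepEps T φ ε) (𝓝[>] (0 : ℝ))

section MeasureTheoryDefs

variable [MeasurableSpace X]

/-- A transition probability kernel on `X`: a measurable assignment of probability
measures. -/
def IsTransKernel (Q : X → Measure X) : Prop :=
  Measurable Q ∧ ∀ x, IsProbabilityMeasure (Q x)

/-- The kernel `Q` is supported by the correspondence `T`. -/
def SupportedBy (T : X → Set X) (Q : X → Measure X) : Prop :=
  ∀ x, Q x (T x) = 1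

/-- `markovLaw μ Q n = μQ^{[n]}`, the law on `X^{n+1}` of the first `n+1` states of the
Markov chain with initial law `μ` and transition kernel `Q`. -/
noncomputable def markovLaw (μ : Measure X) (Q : X → Measure X) :
    (n : ℕ) → Measure (Fin (n + 1) → X)
  | 0 => μ.map fun x => fun _ : Fin 1 => x
  | n + 1 => (markovLaw μ Q n).bind fun x => (Q (x (Fin.last n))).map fun y => Fin.snoc x y

/-- `μQ^{[1]}` as a measure on `X × X`. -/
noncomputable def step2 (μ : Measure X) (Q : X → Measure X) : Measure (X × X) :=
  μ.bind fun x => (Q x).map fun y => (x, y)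

/-- `ν` is the law `μQ^ω` on `X^ℕ` of the full trajectory of the Markov chain with
initial law `μ` and transition kernel `Q`. -/
def IsTrajLaw (μ : Measure X) (Q : X → Measure X) (ν : Measure (ℕ → X)) : Prop :=
  IsProbabilityMeasure ν ∧
    ∀ n : ℕ, ν.map (fun x (i : Fin (n + 1)) => x i.val) = markovLaw μ Q n

end MeasureTheoryDefs

/-- The entropy `H_ν(𝒜)` of the finite measurable partition of `Y` given by the fibers
of `p : Y → I`. -/
noncomputable def partEntropy {Y : Type*} [MeasurableSpace Y] (ν : Measure Y)
    {I : Type*} [Fintype I] (p : Y → I) : ℝ :=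
  ∑ i : I, Real.negMulLog ((ν (p ⁻¹' {i})).toReal)

/-- The measure-theoretic entropy `h_μ(Q)` of a transition probability kernel:
`sup_𝒜 lim_n (1/n) H_{μQ^{[n-1]}}(𝒜ⁿ)` over finite measurable partitions `𝒜` of `X`. -/
noncomputable def kernelEntropy [MeasurableSpace X] (μ : Measure X) (Q : X → Measure X) :
    EReal :=
  ⨆ (m : ℕ) (p : X → Fin m) (_ : Measurable p),
    ((Filter.limsup
        (fun n : ℕ => (n : ℝ)⁻¹ * partEntropy (markovLaw μ Q (n - 1)) fun x => p ∘ x)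
        atTop : ℝ) : EReal)

/-- The Kolmogorov–Sinai entropy `h_ν(g)` of a measurable map `g`:
`sup_𝒫 lim_n (1/n) H_ν(⋁_{i<n} g^{-i}𝒫)` over finite measurable partitions `𝒫`. -/
noncomputable def ksEntropy {Y : Type*} [MeasurableSpace Y] (ν : Measure Y) (g : Y → Y) :
    EReal :=
  ⨆ (m : ℕ) (p : Y → Fin m) (_ : Measurable p),
    ((Filter.limsup
        (fun n : ℕ => (n : ℝ)⁻¹ * partEntropy ν fun y => fun i : Fin n => p (g^[i.val] y))
        atTop : ℝ) : EReal)

/-- The energy term `∫_X ∫_{T(x)} φ(x,y) dQ_x(y) dμ(x)`. -/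
noncomputable def energyInt [MeasurableSpace X] (T : X → Set X) (φ : ↥(graph2 T) → ℝ)
    (Q : X → Measure X) (μ : Measure X) : ℝ :=
  ∫ x, (∫ y in T x, ext2 T φ (x, y) ∂(Q x)) ∂μ

/-- `sup_{Q,μ} { h_μ(Q) + ∫∫ φ dQ dμ }` over transition probability kernels `Q`
supported by `T` and `Q`-invariant Borel probability measures `μ`. -/
noncomputable def varSup [MetricSpace X] [MeasurableSpace X] (T : X → Set X)
    (φ : ↥(graph2 T) → ℝ) : EReal :=
  ⨆ (Q : X → Measure X) (_ : IsTransKernel Q) (_ : SupportedBy T Q) (μ : Measure X)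
    (_ : IsProbabilityMeasure μ) (_ : μ.bind Q = μ),
    kernelEntropy μ Q + ((energyInt T φ Q μ : ℝ) : EReal)

/-- `(μ, Q)` is an equilibrium state for `T` and `φ`. -/
def IsEquilibrium [MetricSpace X] [MeasurableSpace X] (T : X → Set X) (φ : ↥(graph2 T) → ℝ)
    (μ : Measure X) (Q : X → Measure X) : Prop :=
  IsTransKernel Q ∧ SupportedBy T Q ∧ IsProbabilityMeasure μ ∧ μ.bind Q = μ ∧
    pressure T φ = kernelEntropy μ Q + ((energyInt T φ Q μ : ℝ) : EReal)

/-- `H(ρ) = -∑_y ρ{y} log ρ{y}` if `ρ` is supported on a countable set, `∞` otherwise. -/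
noncomputable def atomEntropy {Y : Type*} [MeasurableSpace Y] (ρ : Measure Y) : ℝ≥0∞ :=
  if ∃ A : Set Y, A.Countable ∧ MeasurableSet A ∧ ρ A = 1 then
    ∑' y : Y, ENNReal.ofReal (Real.negMulLog ((ρ {y}).toReal))
  else ⊤

/-- `R` is a backward conditional transition probability kernel of `ν` from `X₂` to `X₁`
supported on `M`. -/
def IsBackwardCondKernel {X₁ X₂ : Type*} [MeasurableSpace X₁] [MeasurableSpace X₂]
    (ν : Measure (X₁ × X₂)) (M : Set (X₁ × X₂)) (R : X₂ → Measure X₁) : Prop :=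
  Measurable R ∧ (∀ x, IsProbabilityMeasure (R x)) ∧
    (∀ x₂ ∈ Prod.snd '' M, R x₂ {x₁ | (x₁, x₂) ∈ M} = 1) ∧
    ∀ C : Set (X₁ × X₂), MeasurableSet C →
      ν C = ∫⁻ x₂, R x₂ {x₁ | (x₁, x₂) ∈ C} ∂(ν.map Prod.snd)

/-- `m(k) = ∑_{l<k} (m_l + p_l)`, the offsets in the specification property. -/
def specShift {n : ℕ} (m p : Fin n → ℕ) (k : ℕ) : ℕ :=
  ∑ l : Fin n, if l.val < k then m l + p l else 0

/-- The specification property for correspondences. -/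
def HasSpecification [MetricSpace X] (T : X → Set X) : Prop :=
  ∀ ε : ℝ, 0 < ε → ∃ M : ℕ, ∀ (n : ℕ) (m p : Fin n → ℕ) (x : Fin n → ℕ → X),
    (∀ j, 1 ≤ m j) → (∀ j, M < p j) → (∀ j, IsOrbitSeg T (m j) (x j)) →
    ∃ z ∈ orbitSpace T, ∀ j : Fin n, ∀ i < m j,
      dist (z (specShift m p j.val + i)) (x j i) < ε

/-- `φ` is Bowen summable w.r.t. the expansive constant `ε`, i.e.
`sup_n K_{φ,T}(ε,n) < ∞`. -/
def BowenSummableWith [MetricSpace X] (T : X → Set X) (φ : ↥(graph2 T) → ℝ) (ε : ℝ) : Prop :=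
  ∃ C : ℝ, ∀ (n : ℕ) (x y : Fin (n + 1) → X), IsFinOrbit T x → IsFinOrbit T y →
    (∀ k, dist (x k) (y k) < ε) → |birkhoff T φ x - birkhoff T φ y| ≤ C

/-- Forward image `T(A) = ⋃_{x ∈ A} T(x)`. -/
def corrImage (T : X → Set X) (A : Set X) : Set X := ⋃ x ∈ A, T x

/-- Iterated forward images `Tⁿ(A)`. -/
def corrIter (T : X → Set X) : ℕ → Set X → Set X
  | 0, A => A
  | n + 1, A => corrImage T (corrIter T n A)

/-- Backward image `T^{-1}(A) = {y : A ∩ T(y) ≠ ∅}`. -/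
def corrPre (T : X → Set X) (A : Set X) : Set X := {y | (A ∩ T y).Nonempty}

/-- Iterated backward images `T^{-n}(A)`. -/
def corrPreIter (T : X → Set X) : ℕ → Set X → Set X
  | 0, A => A
  | n + 1, A => corrPre T (corrPreIter T n A)

/-- `T` is an open correspondence. -/
def IsOpenCorr [MetricSpace X] (T : X → Set X) : Prop :=
  ∀ U : Set X, IsOpen U → IsOpen (corrImage T U)

/-- `T` is strongly transitive: `⋃_{n ≥ 1} T^{-n}(x)` is dense for every `x`. -/
def StronglyTransitive [MetricSpace X] (T : X → Set X) : Prop :=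
  ∀ x : X, Dense (⋃ n : ℕ, corrPreIter T (n + 1) {x})

/-- `T` is distance-expanding. -/
def DistanceExpanding [MetricSpace X] (T : X → Set X) : Prop :=
  ∃ lam : ℝ, 1 < lam ∧ ∃ η : ℝ, 0 < η ∧ ∃ n : ℕ, 1 ≤ n ∧
    ∀ x y : X, dist x y ≤ η →
      ∀ x' ∈ corrIter T n {x}, ∀ y' ∈ corrIter T n {y}, lam * dist x y ≤ dist x' y'

/-- `T` is topologically exact. -/
def TopologicallyExact [MetricSpace X] (T : X → Set X) : Prop :=
  ∀ U : Set X, IsOpen U → U.Nonempty → ∃ N : ℕ, 1 ≤ N ∧ corrIter T N U = Set.univ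

/-- `φ : O₂(T) → ℝ` is Hölder continuous w.r.t. the metric
`d₂((x₁,x₂),(y₁,y₂)) = max (d x₁ y₁) (d x₂ y₂)` (the product metric on `X × X`). -/
def HolderOn [MetricSpace X] (T : X → Set X) (φ : ↥(graph2 T) → ℝ) : Prop :=
  ∃ C : ℝ, 0 < C ∧ ∃ α : ℝ, 0 < α ∧ α ≤ 1 ∧
    ∀ a b : ↥(graph2 T), |φ a - φ b| ≤ C * dist (a : X × X) (b : X × X) ^ α

/-- `O_{-n}(x)`: backward orbits of length `n+1` terminating at `x`. -/
def backOrbits (T : X → Set X) (n : ℕ) (x : X) : Set (Fin (n + 1) → X) :=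
  {y | IsFinOrbit T y ∧ y (Fin.last n) = x}

/-- The lift `φ̃(x₁,x₂,…) = φ(x₁,x₂)` of a potential to the orbit space. -/
def liftPhi (T : X → Set X) (φ : ↥(graph2 T) → ℝ) : ↥(orbitSpace T) → ℝ :=
  fun x => φ ⟨(x.1 0, x.1 1), x.2 0⟩

/-- The Ruelle operator `L_{φ̃}` for the shift on the orbit space:
`(L_{φ̃} Φ)(x) = ∑_{σ(y)=x} Φ(y) exp(φ̃(y))`. -/
noncomputable def ruelleL (T : X → Set X) (φ : ↥(graph2 T) → ℝ)
    (Φ : ↥(orbitSpace T) → ℝ) : ↥(orbitSpace T) → ℝ :=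
  fun x => ∑ᶠ (y : ↥(orbitSpace T)) (_ : shiftOrb T y = x), Φ y * Real.exp (liftPhi T φ y)

/-- Classical topological pressure of a map `g : Y → Y` w.r.t. a potential `ψ` and an
explicit distance function `ρ`, via `(n,ε)`-separated sets. -/
noncomputable def dynPressure {Y : Type*} (ρ : Y → Y → ℝ) (g : Y → Y) (ψ : Y → ℝ) : EReal :=
  Filter.limsup (fun ε : ℝ =>
    Filter.limsup (fun n : ℕ => (((n : ℝ)⁻¹ : ℝ) : EReal) * elog
      (⨆ (E : Set Y) (_ : ∀ x ∈ E, ∀ y ∈ E, x ≠ y → ∃ j < n, ε ≤ ρ (g^[j] x) (g^[j] y)),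
        ∑' x : E, ENNReal.ofReal (Real.exp (∑ j ∈ Finset.range n, ψ (g^[j] (x : Y))))))
      atTop) (𝓝[>] (0 : ℝ))

end Corr
namespace Corr


section Sequences

variable {X : Type*} [MetricSpace X]

lemma dOmega_term_nonneg (x y : ℕ → X) (k : ℕ) :
    0 ≤ (1 / 2 : ℝ) ^ (k + 1) * (dist (x k) (y k) / (1 + dist (x k) (y k))) := by
  positivity

lemma dOmega_term_le (x y : ℕ → X) (k : ℕ) :
    (1 / 2 : ℝ) ^ (k + 1) * (dist (x k) (y k) / (1 + dist (x k) (y k))) ≤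
      (1 / 2 : ℝ) ^ (k + 1) := by
  have h : dist (x k) (y k) / (1 + dist (x k) (y k)) ≤ 1 := by
    rw [div_le_one (by positivity)]
    linarith
  exact mul_le_of_le_one_right (by positivity) h

lemma hasSum_half_pow_succ : HasSum (fun k : ℕ => (1 / 2 : ℝ) ^ (k + 1)) 1 := by
  have h := hasSum_geometric_two.mul_left (1 / 2 : ℝ)
  simpa [pow_succ'] using h

lemma summable_dOmega (x y : ℕ → X) :
    Summable fun k : ℕ =>
      (1 / 2 : ℝ) ^ (k + 1) * (dist (x k) (y k) / (1 + dist (x k) (y k))) :=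
  Summable.of_nonneg_of_le (dOmega_term_nonneg x y) (dOmega_term_le x y)
    hasSum_half_pow_succ.summable

lemma le_dOmega {x y : ℕ → X} {ε : ℝ} (hε : 0 < ε) {k : ℕ} (hk : k ≤ 1)
    (h : ε ≤ dist (x k) (y k)) : ε / (4 * (1 + ε)) ≤ dOmega x y := by
  have hterm := (summable_dOmega x y).le_tsum k fun i _ => dOmega_term_nonneg x y i
  refine le_trans ?_ hterm
  have hquot : ε / (1 + ε) ≤ dist (x k) (y k) / (1 + dist (x k) (y k)) := by
    rw [div_le_div_iff₀ (by positivity) (by positivity)]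
    nlinarith
  have hpow : (1 / 4 : ℝ) ≤ (1 / 2) ^ (k + 1) := by
    interval_cases k <;> norm_num
  calc ε / (4 * (1 + ε)) = 1 / 4 * (ε / (1 + ε)) := by field_simp
    _ ≤ _ := by gcongr

lemma dOmega_le {x y : ℕ → X} {δ : ℝ} {N : ℕ}
    (h : ∀ k < N, dist (x k) (y k) ≤ δ) (hδ : 0 ≤ δ) :
    dOmega x y ≤ δ + (1 / 2 : ℝ) ^ N := by
  rw [dOmega, ← (summable_dOmega x y).sum_add_tsum_nat_add N]
  refine add_le_add ?_ ?_
  · calc _ ≤ ∑ k ∈ Finset.range N, (1 / 2 : ℝ) ^ (k + 1) * δ := by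
          refine Finset.sum_le_sum fun k hk => ?_
          have hd := h k (Finset.mem_range.1 hk)
          gcongr
          exact (div_le_self dist_nonneg (by linarith [dist_nonneg (x := x k) (y := y k)])).trans hd
      _ = (∑ k ∈ Finset.range N, (1 / 2 : ℝ) ^ (k + 1)) * δ := by rw [Finset.sum_mul]
      _ ≤ 1 * δ := by
          gcongr
          exact sum_le_hasSum _ (fun _ _ => by positivity) hasSum_half_pow_succ
      _ = δ := one_mul δ
  · have hs : HasSum (fun k : ℕ => (1 / 2 : ℝ) ^ (k + N + 1)) ((1 / 2 : ℝ) ^ N) := by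
      have := hasSum_half_pow_succ.mul_left ((1 / 2 : ℝ) ^ N)
      simp only [← pow_add, mul_one] at this
      simpa only [add_comm _ N, add_assoc] using this
    rw [← hs.tsum_eq]
    exact Summable.tsum_le_tsum (fun k => dOmega_term_le x y (k + N))
      ((summable_nat_add_iff N).2 (summable_dOmega x y)) hs.summable

end Sequences

section Orbits

variable {X : Type*} {T : X → Set X}

lemma shiftOrb_iterate_apply (j : ℕ) (x : ↥(orbitSpace T)) (k : ℕ) :
    ((shiftOrb T)^[j] x).1 k = x.1 (j + k) := by
  induction j generalizing x with
  | zero => simp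
  | succ j ih =>
    rw [Function.iterate_succ_apply, ih]
    change x.1 (j + k + 1) = _
    exact congrArg x.1 (by omega)

/-- The first `n + 1` entries of an orbit. -/
def truncOrbit (n : ℕ) (x : ↥(orbitSpace T)) : Fin (n + 1) → X := fun i => x.1 i

lemma truncOrbit_mem (n : ℕ) (x : ↥(orbitSpace T)) : truncOrbit n x ∈ finOrbits T n :=
  fun i => x.2 i

lemma exists_truncOrbit_eq (hT : ∀ x, (T x).Nonempty) {n : ℕ} {x : Fin (n + 1) → X}
    (hx : x ∈ finOrbits T n) : ∃ z : ↥(orbitSpace T), truncOrbit n z = x := by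
  choose s hs using hT
  refine ⟨⟨fun k => s^[k - n] (x ⟨min k n, by omega⟩), fun k => ?_⟩, ?_⟩
  · rcases lt_or_ge k n with hk | hk
    · have h := hx ⟨k, hk⟩
      have h₁ : k + 1 - n = 0 := by omega
      have h₂ : k - n = 0 := by omega
      have h₃ : min (k + 1) n = k + 1 := by omega
      have h₄ : min k n = k := by omega
      simp only [h₁, h₂, h₃, h₄, Function.iterate_zero, id]
      exact h
    · have h₁ : k + 1 - n = (k - n) + 1 := by omega
      have h₃ : min (k + 1) n = n := by omega
      have h₄ : min k n = n := by omega
      simp only [h₁, h₃, h₄, Function.iterate_succ_apply']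
      exact hs _
  · funext i
    have h₁ : (i : ℕ) - n = 0 := by omega
    have h₂ : min (i : ℕ) n = i := by omega
    simp only [truncOrbit, h₁, h₂, Function.iterate_zero, id]

lemma sum_liftPhi_eq_birkhoff (φ : ↥(graph2 T) → ℝ) (n : ℕ) (x : ↥(orbitSpace T)) :
    ∑ j ∈ Finset.range n, liftPhi T φ ((shiftOrb T)^[j] x) = birkhoff T φ (truncOrbit n x) := by
  rw [Finset.sum_range, birkhoff]
  refine Finset.sum_congr rfl fun i _ => ?_
  have hi : (truncOrbit n x i.castSucc, truncOrbit n x i.succ) ∈ graph2 T := x.2 i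
  rw [ext2, dif_pos hi, liftPhi]
  congr 1
  simp [shiftOrb_iterate_apply, truncOrbit]

end Orbits

lemma elog_eq_log (x : ℝ≥0∞) : elog x = ENNReal.log x := rfl

lemma elog_mono : Monotone elog := fun x y h => by
  simpa only [elog_eq_log] using ENNReal.log_monotone h

lemma elog_mul (x y : ℝ≥0∞) : elog (x * y) = elog x + elog y := by
  simpa only [elog_eq_log] using ENNReal.log_mul_add

/-- The growth rate of a sequence is not increased by a bounded factor. -/
lemma limsup_inv_mul_elog_le_of_le_mul {a b : ℕ → ℝ≥0∞} (K : ℕ)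
    (h : ∀ n, a n ≤ (K + 1 : ℕ) * b n) :
    limsup (fun n : ℕ => (((n : ℝ)⁻¹ : ℝ) : EReal) * elog (a n)) atTop ≤
      limsup (fun n : ℕ => (((n : ℝ)⁻¹ : ℝ) : EReal) * elog (b n)) atTop := by
  have hK : elog ((K + 1 : ℕ) : ℝ≥0∞) = ((Real.log (K + 1 : ℕ) : ℝ) : EReal) := by
    rw [elog, if_neg (by simp), if_neg (by simp), ENNReal.toReal_natCast]
  set u : ℕ → EReal := fun n => (((n : ℝ)⁻¹ * Real.log (K + 1 : ℕ) : ℝ) : EReal) with hu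
  have hu0 : Tendsto u atTop (𝓝 0) := by
    have h0 : Tendsto (fun n : ℕ => (n : ℝ)⁻¹ * Real.log (K + 1 : ℕ)) atTop (𝓝 0) := by
      simpa using (tendsto_inv_atTop_nhds_zero_nat (𝕜 := ℝ)).mul_const (Real.log (K + 1 : ℕ))
    exact (continuous_coe_real_ereal.tendsto 0).comp h0
  have hu_lim : limsup u atTop = 0 := hu0.limsup_eq
  calc _ ≤ limsup (u + fun n : ℕ => (((n : ℝ)⁻¹ : ℝ) : EReal) * elog (b n)) atTop := by
        refine limsup_le_limsup (Eventually.of_forall fun n => ?_)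
        have hn : (0 : EReal) ≤ (((n : ℝ)⁻¹ : ℝ) : EReal) := by
          exact_mod_cast inv_nonneg.2 (Nat.cast_nonneg n)
        have hle : elog (a n) ≤ elog ((K + 1 : ℕ) : ℝ≥0∞) + elog (b n) :=
          (elog_mono (h n)).trans_eq (elog_mul _ _)
        refine (mul_le_mul_of_nonneg_left hle hn).trans_eq ?_
        rw [hK, EReal.left_distrib_of_nonneg_of_ne_top hn (EReal.coe_ne_top _)]
        simp only [hu, Pi.add_apply, EReal.coe_mul]
    _ ≤ limsup u atTop +
          limsup (fun n : ℕ => (((n : ℝ)⁻¹ : ℝ) : EReal) * elog (b n)) atTop :=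
        EReal.limsup_add_le (by simp [hu_lim]) (by simp [hu_lim])
    _ = _ := by rw [hu_lim, zero_add]

lemma limsup_nhdsGT_le_of_le_comp {f g : ℝ → EReal} {h : ℝ → ℝ}
    (hh : Tendsto h (𝓝[>] 0) (𝓝[>] 0)) (hfg : ∀ ε > 0, f ε ≤ g (h ε)) :
    limsup f (𝓝[>] 0) ≤ limsup g (𝓝[>] 0) :=
  calc limsup f (𝓝[>] 0) ≤ limsup (g ∘ h) (𝓝[>] 0) :=
        limsup_le_limsup (eventually_mem_nhdsWithin.mono hfg)
    _ = limsup g (map h (𝓝[>] 0)) := rfl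
    _ ≤ limsup g (𝓝[>] 0) := limsup_le_limsup_of_le hh

/-- `E` is `(n, ε)`-separated for the map `g` and the distance function `ρ`. -/
def DynSep {Y : Type*} (ρ : Y → Y → ℝ) (g : Y → Y) (n : ℕ) (ε : ℝ) (E : Set Y) : Prop :=
  ∀ x ∈ E, ∀ y ∈ E, x ≠ y → ∃ j < n, ε ≤ ρ (g^[j] x) (g^[j] y)

/-- The supremum of the exponential Birkhoff sums over `(n, ε)`-separated sets. -/
noncomputable def dynSepSup {Y : Type*} (ρ : Y → Y → ℝ) (g : Y → Y) (ψ : Y → ℝ)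
    (n : ℕ) (ε : ℝ) : ℝ≥0∞ :=
  ⨆ (E : Set Y) (_ : DynSep ρ g n ε E),
    ∑' x : E, ENNReal.ofReal (Real.exp (∑ j ∈ Finset.range n, ψ (g^[j] (x : Y))))

section Comparison

variable {X : Type*} [MetricSpace X] {T : X → Set X} (φ : ↥(graph2 T) → ℝ)

lemma sepSup_le_dynSepSup (hT : ∀ x, (T x).Nonempty) {ε : ℝ} (hε : 0 < ε) {n : ℕ}
    (hn : 1 ≤ n) :
    sepSup T φ n ε ≤ dynSepSup (fun x y : ↥(orbitSpace T) => dOmega x.1 y.1) (shiftOrb T)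
      (liftPhi T φ) n (ε / (4 * (1 + ε))) := by
  refine iSup_le fun E => iSup₂_le fun hE hsep => ?_
  choose z hz using fun x : E => exists_truncOrbit_eq hT (hE x.2)
  have hz_inj : Function.Injective z := fun a b hab => Subtype.ext <| by
    rw [← hz a, ← hz b, hab]
  have hz_sep : DynSep (fun x y : ↥(orbitSpace T) => dOmega x.1 y.1) (shiftOrb T) n
      (ε / (4 * (1 + ε))) (range z) := by
    rintro _ ⟨a, rfl⟩ _ ⟨b, rfl⟩ hab
    have hab' : (a : Fin (n + 1) → X) ≠ b := fun h => hab (congrArg z (Subtype.ext h))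
    obtain ⟨i, hi⟩ : ∃ i, ε ≤ dist ((a : Fin (n + 1) → X) i) ((b : Fin (n + 1) → X) i) := by
      by_contra! hlt
      exact (hsep a a.2 b b.2 hab').not_gt ((dist_pi_lt_iff hε).2 hlt)
    obtain ⟨j, k, hj, hk, hjk⟩ : ∃ j k : ℕ, j < n ∧ k ≤ 1 ∧ j + k = i := by
      rcases Nat.lt_or_ge i n with h | h
      · exact ⟨i, 0, h, by omega, rfl⟩
      · exact ⟨n - 1, 1, by omega, le_rfl, by omega⟩
    refine ⟨j, hj, le_dOmega hε hk ?_⟩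
    have ha := congrFun (hz a) i
    have hb := congrFun (hz b) i
    rw [shiftOrb_iterate_apply, shiftOrb_iterate_apply, hjk]
    exact hi.trans_eq (by rw [← ha, ← hb]; rfl)
  refine le_trans (le_of_eq ?_) (le_iSup₂_of_le (range z) hz_sep le_rfl)
  rw [tsum_range (fun x => ENNReal.ofReal (Real.exp
    (∑ j ∈ Finset.range n, liftPhi T φ ((shiftOrb T)^[j] x)))) hz_inj]
  simp only [sum_liftPhi_eq_birkhoff, hz, orbSum]

lemma tsum_le_sepSup_of_truncOrbit_sep {ε : ℝ} (hε : 0 < ε) (n : ℕ)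
    {E : Set ↥(orbitSpace T)}
    (hE : ∀ x ∈ E, ∀ y ∈ E, x ≠ y → ε ≤ dist (truncOrbit n x) (truncOrbit n y)) :
    ∑' x : E, ENNReal.ofReal (Real.exp
      (∑ j ∈ Finset.range n, liftPhi T φ ((shiftOrb T)^[j] (x : ↥(orbitSpace T))))) ≤
      sepSup T φ n ε := by
  have hinj : InjOn (truncOrbit n) E := fun x hx y hy hxy => by
    by_contra hne
    have := hE x hx y hy hne
    rw [hxy, dist_self] at this
    linarith
  have hsub : truncOrbit n '' E ⊆ finOrbits T n := by
    rintro _ ⟨x, -, rfl⟩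
    exact truncOrbit_mem n x
  have hsep : eSep ε (truncOrbit n '' E) := by
    rintro _ ⟨x, hx, rfl⟩ _ ⟨y, hy, rfl⟩ hxy
    exact hE x hx y hy fun h => hxy (h ▸ rfl)
  refine le_trans (le_of_eq ?_)
    (le_iSup_of_le (truncOrbit n '' E) (le_iSup₂_of_le hsub hsep le_rfl))
  rw [orbSum, tsum_image (fun x => ENNReal.ofReal (Real.exp (birkhoff T φ x))) hinj]
  simp only [sum_liftPhi_eq_birkhoff]

lemma exists_dynSepSup_le_mul_sepSup [CompactSpace X] {ε : ℝ} (hε : 0 < ε) :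
    ∃ K : ℕ, ∀ n, dynSepSup (fun x y : ↥(orbitSpace T) => dOmega x.1 y.1) (shiftOrb T)
      (liftPhi T φ) n ε ≤ (K + 1 : ℕ) * sepSup T φ n (ε / 2) := by
  obtain ⟨N, hN⟩ := exists_pow_lt_of_lt_one (half_pos hε) (by norm_num : (1 / 2 : ℝ) < 1)
  obtain ⟨t, -, ht_fin, ht⟩ := (isCompact_univ (X := X)).finite_cover_balls
    (by positivity : 0 < ε / 4)
  have hnet : ∀ x : X, ∃ c : t, dist x c < ε / 4 := fun x => by
    obtain ⟨c, hc, hxc⟩ := mem_iUnion₂.1 (ht (mem_univ x))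
    exact ⟨⟨c, hc⟩, hxc⟩
  choose p hp using hnet
  have : Fintype t := ht_fin.fintype
  refine ⟨Fintype.card (Fin N → t), fun n => iSup₂_le fun E hE => ?_⟩
  let q : ↥(orbitSpace T) → Fin N → t := fun x k => p (x.1 (n + 1 + k))
  have hcover : E = ⋃ i, E ∩ q ⁻¹' {i} := by
    ext x
    simp
  have hpart : ∀ i, ∀ x ∈ E ∩ q ⁻¹' {i}, ∀ y ∈ E ∩ q ⁻¹' {i}, x ≠ y →
      ε / 2 ≤ dist (truncOrbit n x) (truncOrbit n y) := by
    rintro i x ⟨hx, hxi⟩ y ⟨hy, hyi⟩ hxy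
    by_contra! hlt
    obtain ⟨j, hj, hjε⟩ := hE x hx y hy hxy
    have hclose : ∀ k < N, dist (((shiftOrb T)^[j] x).1 k) (((shiftOrb T)^[j] y).1 k) ≤
        ε / 2 := by
      intro k hk
      rw [shiftOrb_iterate_apply, shiftOrb_iterate_apply]
      rcases Nat.lt_or_ge (j + k) (n + 1) with h | h
      · exact (dist_le_pi_dist (truncOrbit n x) (truncOrbit n y) ⟨j + k, h⟩).trans hlt.le
      · obtain ⟨l, hl⟩ := Nat.exists_eq_add_of_le h
        have hq : q x = q y := by
          rw [mem_singleton_iff.1 hxi, mem_singleton_iff.1 hyi]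
        have hpl : p (x.1 (n + 1 + l)) = p (y.1 (n + 1 + l)) :=
          congrFun hq ⟨l, by omega⟩
        have h₁ := hp (x.1 (n + 1 + l))
        have h₂ := hp (y.1 (n + 1 + l))
        rw [hl]
        rw [← hpl] at h₂
        have := dist_triangle_right (x.1 (n + 1 + l)) (y.1 (n + 1 + l))
          (p (x.1 (n + 1 + l)) : X)
        linarith
    have := dOmega_le hclose (half_pos hε).le
    linarith
  let w : ↥(orbitSpace T) → ℝ≥0∞ := fun x => ENNReal.ofReal (Real.exp
    (∑ j ∈ Finset.range n, liftPhi T φ ((shiftOrb T)^[j] x)))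
  calc ∑' x : E, w x = ∑' x : ⋃ i, E ∩ q ⁻¹' {i}, w x := by rw [← hcover]
    _ ≤ ∑ i, ∑' x : ↥(E ∩ q ⁻¹' {i}), w x := ENNReal.tsum_iUnion_le w _
    _ ≤ ∑ _i : Fin N → t, sepSup T φ n (ε / 2) := Finset.sum_le_sum fun i _ =>
        tsum_le_sepSup_of_truncOrbit_sep φ (half_pos hε) n (hpart i)
    _ = (Fintype.card (Fin N → t) : ℝ≥0∞) * sepSup T φ n (ε / 2) := by
        rw [Finset.sum_const, nsmul_eq_mul, Finset.card_univ]
    _ ≤ _ := by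
        gcongr
        exact Nat.le_succ _

end Comparison

/-- The topological pressure of a correspondence equals the classical topological
pressure of the shift map `σ : O_ω(T) → O_ω(T)` (w.r.t. the metric `d_ω`) with the
lifted potential `φ̃`. -/
theorem pressure_eq_shift_pressure
    {X : Type*} [MetricSpace X] [CompactSpace X]
    (T : X → Set X) (hT : IsCorrespondence T) (φ : ↥(graph2 T) → ℝ) (hφ : Continuous φ) :
    pressure T φ =
      dynPressure (fun x y : ↥(orbitSpace T) => dOmega x.1 y.1) (shiftOrb T)
        (liftPhi T φ) := by
  refine le_antisymm ?_ ?_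
  · refine limsup_nhdsGT_le_of_le_comp (h := fun ε => ε / (4 * (1 + ε))) ?_ fun ε hε => ?_
    · refine tendsto_nhdsWithin_iff.2 ⟨?_, ?_⟩
      · have hc : ContinuousAt (fun ε : ℝ => ε / (4 * (1 + ε))) 0 :=
          ContinuousAt.div (by fun_prop) (by fun_prop) (by norm_num)
        simpa [ContinuousAt] using hc.mono_left nhdsWithin_le_nhds
      · filter_upwards [self_mem_nhdsWithin] with ε hε
        have : (0 : ℝ) < ε := hε
        exact mem_Ioi.2 (by positivity)
    · refine limsup_le_limsup ?_
      filter_upwards [eventually_ge_atTop 1] with n hn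
      have hn0 : (0 : EReal) ≤ (((n : ℝ)⁻¹ : ℝ) : EReal) := by
        exact_mod_cast inv_nonneg.2 (Nat.cast_nonneg n)
      exact mul_le_mul_of_nonneg_left (elog_mono (sepSup_le_dynSepSup φ hT.1 hε hn)) hn0
  · refine limsup_nhdsGT_le_of_le_comp (h := fun ε => ε / 2) ?_ fun ε hε => ?_
    · refine tendsto_nhdsWithin_iff.2 ⟨?_, ?_⟩
      · have hc : ContinuousAt (fun ε : ℝ => ε / 2) 0 := by fun_prop
        simpa [ContinuousAt] using hc.mono_left nhdsWithin_le_nhds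
      · filter_upwards [self_mem_nhdsWithin] with ε hε
        exact mem_Ioi.2 (half_pos hε)
    · obtain ⟨K, hK⟩ := exists_dynSepSup_le_mul_sepSup φ hε
      exact limsup_inv_mul_elog_le_of_le_mul K hK

end Corr
end

section
/- Entropy of a transition probability kernel equals the entropy of the induced shift: Let (X, 𝓜) be a measurable space, Q a transition probability kernel on X, μ a Q-invariant probability measure on X, and σ′ the shift map σ′(x₁,x₂,…) := (x₂,x₃,…) on X^ℕ equipped with the product σ-algebra. Then the measure μQ^ω on X^ℕ is σ′-invariant and h_μ(Q) = h_{μQ^ω}(σ′), where h_{μQ^ω}(σ′) is the Kolmogorov–Sinai measure-theoretic entropy of σ′ with respect to μQ^ω. -/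
open Filter MeasureTheory Set
open scoped Topology ENNReal Classical

namespace Corr

open Real (negMulLog)

section PartitionEntropy

lemma negMulLog_sum_le {J : Type*} (s : Finset J) (w : J → ℝ) (hw : ∀ j ∈ s, 0 ≤ w j) :
    negMulLog (∑ j ∈ s, w j) ≤ ∑ j ∈ s, negMulLog (w j) := by
  simp only [negMulLog, ← Finset.sum_neg_distrib, Finset.sum_mul]
  refine Finset.sum_le_sum fun j hj => ?_
  rcases (hw j hj).eq_or_lt with h | h
  · simp [← h]
  · have := Real.log_le_log h (Finset.single_le_sum hw hj)
    nlinarith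

lemma sub_mul_div_le_mul_log {w a b c : ℝ} (hw : 0 ≤ w) (ha : w ≤ a) (hb : w ≤ b) (hc : w ≤ c) :
    w - a * b / c ≤ w * (Real.log c + Real.log w - Real.log a - Real.log b) := by
  rcases hw.eq_or_lt with h | h
  · subst h
    have : 0 ≤ a * b / c := by positivity
    simpa using this
  · have ha' := h.trans_le ha
    have hb' := h.trans_le hb
    have hc' := h.trans_le hc
    have key := Real.log_le_sub_one_of_pos (x := a * b / (c * w)) (by positivity)
    rw [Real.log_div (by positivity) (by positivity), Real.log_mul ha'.ne' hb'.ne',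
      Real.log_mul hc'.ne' h.ne'] at key
    have h2 : w * (a * b / (c * w)) = a * b / c := by field_simp
    nlinarith [mul_le_mul_of_nonneg_left key hw]

lemma sum_negMulLog_submodular {I J K : Type*} [Fintype I] [Fintype J] [Fintype K]
    (w : I → J → K → ℝ) (hw : ∀ i j k, 0 ≤ w i j k) :
    ∑ i, ∑ j, ∑ k, negMulLog (w i j k) + ∑ k, negMulLog (∑ i, ∑ j, w i j k) ≤
      ∑ i, ∑ k, negMulLog (∑ j, w i j k) + ∑ j, ∑ k, negMulLog (∑ i, w i j k) := by
  set a : I → K → ℝ := fun i k => ∑ j, w i j k with ha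
  set b : J → K → ℝ := fun j k => ∑ i, w i j k with hb
  set c : K → ℝ := fun k => ∑ i, ∑ j, w i j k with hc
  have hac : ∀ k, c k = ∑ i, a i k := fun k => rfl
  have hbc : ∀ k, c k = ∑ j, b j k := fun k => Finset.sum_comm
  have ha0 : ∀ i k, 0 ≤ a i k := fun i k => Finset.sum_nonneg fun j _ => hw i j k
  have hb0 : ∀ j k, 0 ≤ b j k := fun j k => Finset.sum_nonneg fun i _ => hw i j k
  have hwa : ∀ i j k, w i j k ≤ a i k := fun i j k =>
    Finset.single_le_sum (f := fun j => w i j k) (fun j _ => hw i j k) (Finset.mem_univ j)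
  have hwb : ∀ i j k, w i j k ≤ b j k := fun i j k =>
    Finset.single_le_sum (f := fun i => w i j k) (fun i _ => hw i j k) (Finset.mem_univ i)
  have hcc : ∀ i j k, w i j k ≤ c k := fun i j k => (hwa i j k).trans <|
    Finset.single_le_sum (f := fun i => a i k) (fun i _ => ha0 i k) (Finset.mem_univ i)
  have key : ∑ k, ∑ i, ∑ j, (w i j k - a i k * b j k / c k) ≤
      ∑ k, ∑ i, ∑ j, w i j k *
        (Real.log (c k) + Real.log (w i j k) - Real.log (a i k) - Real.log (b j k)) := by
    gcongr with k _ i _ j _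
    exact sub_mul_div_le_mul_log (hw i j k) (hwa i j k) (hwb i j k) (hcc i j k)
  have hlhs : ∑ k, ∑ i, ∑ j, (w i j k - a i k * b j k / c k) = 0 := by
    refine Finset.sum_eq_zero fun k _ => ?_
    simp only [Finset.sum_sub_distrib, ← Finset.sum_div, ← Finset.mul_sum, ← Finset.sum_mul,
      ← hac, ← hbc]
    exact sub_eq_zero.2 (mul_self_div_self (c k)).symm
  have hrhs : ∑ k, ∑ i, ∑ j, w i j k *
        (Real.log (c k) + Real.log (w i j k) - Real.log (a i k) - Real.log (b j k)) =
      -∑ k, negMulLog (c k) - ∑ k, ∑ i, ∑ j, negMulLog (w i j k)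
        + ∑ k, ∑ i, negMulLog (a i k) + ∑ k, ∑ j, negMulLog (b j k) := by
    simp only [← Finset.sum_neg_distrib, ← Finset.sum_sub_distrib, ← Finset.sum_add_distrib]
    refine Finset.sum_congr rfl fun k _ => ?_
    have h1 : ∑ i, ∑ j, w i j k * Real.log (c k) = -negMulLog (c k) := by
      simp only [← Finset.sum_mul, negMulLog, hc]; ring
    have h2 : ∑ i, ∑ j, w i j k * Real.log (w i j k) = -∑ i, ∑ j, negMulLog (w i j k) := by
      simp [negMulLog]
    have h3 : ∑ i, ∑ j, w i j k * Real.log (a i k) = -∑ i, negMulLog (a i k) := by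
      simp [negMulLog, ← Finset.sum_mul, ha]
    have h4 : ∑ i, ∑ j, w i j k * Real.log (b j k) = -∑ j, negMulLog (b j k) := by
      rw [Finset.sum_comm]; simp [negMulLog, ← Finset.sum_mul, hb]
    simp only [mul_sub, mul_add, Finset.sum_sub_distrib, Finset.sum_add_distrib, h1, h2, h3, h4]
    ring
  rw [hlhs, hrhs] at key
  have e1 : ∑ i, ∑ j, ∑ k, negMulLog (w i j k) = ∑ k, ∑ i, ∑ j, negMulLog (w i j k) := by
    rw [Finset.sum_comm (s := (Finset.univ : Finset K))]
    exact Finset.sum_congr rfl fun i _ => Finset.sum_comm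
  rw [e1, Finset.sum_comm (f := fun i k => negMulLog (a i k)),
    Finset.sum_comm (f := fun j k => negMulLog (b j k))]
  linarith

variable {Y : Type*} [MeasurableSpace Y] {ν : Measure Y}
  {I J K : Type*} [Fintype I] [Fintype J] [Fintype K]

lemma partEntropy_nonneg [IsProbabilityMeasure ν] (b : Y → J) : 0 ≤ partEntropy ν b :=
  Finset.sum_nonneg fun _ _ => Real.negMulLog_nonneg measureReal_nonneg measureReal_le_one

lemma partEntropy_of_unique [IsProbabilityMeasure ν] [Unique I] (a : Y → I) :
    partEntropy ν a = 0 := by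
  have : a ⁻¹' {default} = univ := by ext y; simp [Subsingleton.elim (a y) default]
  simp [partEntropy, this]

variable [MeasurableSpace J] [MeasurableSingletonClass J]

lemma partEntropy_comp_le [IsFiniteMeasure ν] {b : Y → J} (hb : Measurable b) (f : J → I) :
    partEntropy ν (f ∘ b) ≤ partEntropy ν b := by
  have h : ∀ i, ν.real ((f ∘ b) ⁻¹' {i}) = ∑ j with f j = i, ν.real (b ⁻¹' {j}) := fun i => by
    rw [sum_measureReal_preimage_singleton]
    · congr 1; ext y; simp
    · exact fun j _ => hb (measurableSet_singleton j)
  calc partEntropy ν (f ∘ b) = ∑ i, negMulLog (∑ j with f j = i, ν.real (b ⁻¹' {j})) :=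
        Finset.sum_congr rfl fun i _ => congrArg negMulLog (h i)
    _ ≤ ∑ i, ∑ j with f j = i, negMulLog (ν.real (b ⁻¹' {j})) := by
        gcongr with i
        exact negMulLog_sum_le _ _ fun _ _ => measureReal_nonneg
    _ = partEntropy ν b := Finset.sum_fiberwise _ _ _

lemma partEntropy_le_of_determines [IsFiniteMeasure ν] {a : Y → I} {b : Y → J} (hb : Measurable b)
    (h : ∀ y z, b y = b z → a y = a z) : partEntropy ν a ≤ partEntropy ν b := by
  rcases isEmpty_or_nonempty Y with hY | ⟨⟨y₀⟩⟩
  · simp [partEntropy, Set.eq_empty_of_isEmpty]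
  · have : a = Function.extend b a (fun _ => a y₀) ∘ b := by
      ext y
      exact (Function.FactorsThrough.extend_apply (fun y z hyz => h y z hyz) _ y).symm
    rw [this]
    exact partEntropy_comp_le hb _

lemma sum_measureReal_inter_preimage [IsFiniteMeasure ν] {b : Y → J} (hb : Measurable b)
    (s : Set Y) :
    ∑ j, ν.real (s ∩ b ⁻¹' {j}) = ν.real s := by
  have := sum_measureReal_preimage_singleton (μ := ν.restrict s) (f := b) Finset.univ
    (fun j _ => hb (measurableSet_singleton j))
  simpa [measureReal_restrict_apply (hb (measurableSet_singleton _)), inter_comm s] using this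

lemma partEntropy_comp_measurePreserving {g : Y → Y} (hg : MeasurePreserving g ν ν)
    {b : Y → J} (hb : Measurable b) : partEntropy ν (fun y => b (g y)) = partEntropy ν b := by
  refine Finset.sum_congr rfl fun j _ => ?_
  rw [← hg.measure_preimage (hb (measurableSet_singleton j)).nullMeasurableSet]
  rfl

variable [MeasurableSpace I] [MeasurableSingletonClass I]

lemma partEntropy_submodular [IsFiniteMeasure ν] {a : Y → I} {b : Y → J}
    (ha : Measurable a) (hb : Measurable b) (c : Y → K) :
    partEntropy ν (fun y => (a y, b y, c y)) + partEntropy ν c ≤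
      partEntropy ν (fun y => (a y, c y)) + partEntropy ν (fun y => (b y, c y)) := by
  have key := sum_negMulLog_submodular
    (fun i j k => ν.real (a ⁻¹' {i} ∩ (b ⁻¹' {j} ∩ c ⁻¹' {k}))) (fun _ _ _ => measureReal_nonneg)
  have h1 : ∀ i k, ∑ j, ν.real (a ⁻¹' {i} ∩ (b ⁻¹' {j} ∩ c ⁻¹' {k})) =
      ν.real (a ⁻¹' {i} ∩ c ⁻¹' {k}) := fun i k => by
    rw [← sum_measureReal_inter_preimage hb]
    simp only [inter_left_comm, inter_comm]
  have h2 : ∀ j k, ∑ i, ν.real (a ⁻¹' {i} ∩ (b ⁻¹' {j} ∩ c ⁻¹' {k})) =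
      ν.real (b ⁻¹' {j} ∩ c ⁻¹' {k}) := fun j k => by
    rw [← sum_measureReal_inter_preimage ha]
    simp only [inter_comm]
  have h3 : ∀ k, ∑ i, ν.real (a ⁻¹' {i} ∩ c ⁻¹' {k}) = ν.real (c ⁻¹' {k}) := fun k => by
    rw [← sum_measureReal_inter_preimage ha]
    simp only [inter_comm]
  simp only [h1, h2, h3] at key
  simpa only [partEntropy, Fintype.sum_prod_type, ← measureReal_def, ← singleton_prod_singleton,
    mk_preimage_prod] using key

lemma partEntropy_prod_le [IsProbabilityMeasure ν] {a : Y → I} {b : Y → J}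
    (ha : Measurable a) (hb : Measurable b) :
    partEntropy ν (fun y => (a y, b y)) ≤ partEntropy ν a + partEntropy ν b := by
  have key := partEntropy_submodular (ν := ν) ha hb (fun _ => ())
  have h0 := partEntropy_of_unique (ν := ν) (fun _ : Y => ())
  have h1 : partEntropy ν (fun y => (a y, b y)) ≤ partEntropy ν (fun y => (a y, b y, ())) :=
    partEntropy_le_of_determines (by fun_prop) (by simp)
  have h2 : partEntropy ν (fun y => (a y, ())) ≤ partEntropy ν a :=
    partEntropy_le_of_determines ha (by simp)
  have h3 : partEntropy ν (fun y => (b y, ())) ≤ partEntropy ν b :=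
    partEntropy_le_of_determines hb (by simp)
  linarith

end PartitionEntropy

lemma partEntropy_map {Y Z J : Type*} [MeasurableSpace Y] [MeasurableSpace Z] [Fintype J]
    [MeasurableSpace J] [MeasurableSingletonClass J] {ν : Measure Y} {f : Y → Z} {b : Z → J}
    (hf : Measurable f) (hb : Measurable b) :
    partEntropy (ν.map f) b = partEntropy ν (fun y => b (f y)) := by
  refine Finset.sum_congr rfl fun j _ => ?_
  rw [Measure.map_apply hf (hb (measurableSet_singleton j))]
  rfl

lemma exists_forall_abs_partEntropy_sub_lt {Y J : Type*} [MeasurableSpace Y] [Fintype J]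
    [MeasurableSpace J] [MeasurableSingletonClass J] {ν : Measure Y} [IsFiniteMeasure ν]
    {a : Y → J} (ha : Measurable a) {ε : ℝ} (hε : 0 < ε) :
    ∃ δ > 0, ∀ b : Y → J, Measurable b → ν.real {y | a y ≠ b y} < δ →
      |partEntropy ν b - partEntropy ν a| < ε := by
  have hcont : Continuous fun w : J → ℝ => ∑ j, negMulLog (w j) := by fun_prop
  obtain ⟨δ, hδ, h⟩ := Metric.continuous_iff.1 hcont (fun j => ν.real (a ⁻¹' {j})) ε hε
  refine ⟨δ, hδ, fun b hb hab => h (fun j => ν.real (b ⁻¹' {j})) ?_⟩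
  refine (dist_pi_lt_iff hδ).2 fun j => lt_of_le_of_lt ?_ hab
  refine (abs_measureReal_sub_le_measureReal_symmDiff
    (hb (measurableSet_singleton j)).nullMeasurableSet
    (ha (measurableSet_singleton j)).nullMeasurableSet).trans (measureReal_mono ?_)
  rintro y (⟨h1, h2⟩ | ⟨h1, h2⟩)
  · rintro h
    exact h2 (h.trans h1)
  · rintro h
    exact h2 (h.symm.trans h1)

section Itinerary

variable {Y I J : Type*}

/-- The first `n` symbols of the orbit of a point under `g`, read through `p`. -/
def itinerary (g : Y → Y) (p : Y → I) (n : ℕ) : Y → Fin n → I := fun y i => p (g^[i.val] y)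

lemma itinerary_succ_eq {g : Y → Y} {p : Y → I} {n : ℕ} {y z : Y}
    (h : itinerary g p n y = itinerary g p n z) (h' : p (g^[n] y) = p (g^[n] z)) :
    itinerary g p (n + 1) y = itinerary g p (n + 1) z := by
  funext i
  rcases Nat.lt_succ_iff_lt_or_eq.1 i.isLt with hi | hi
  · exact congrFun h ⟨i, hi⟩
  · simpa only [itinerary, hi] using h'

variable [MeasurableSpace Y] {ν : Measure Y} {g : Y → Y}
  [Fintype I] [MeasurableSpace I] [MeasurableSingletonClass I]
  [Fintype J] [MeasurableSpace J] [MeasurableSingletonClass J]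

lemma measurable_itinerary {I : Type*} [MeasurableSpace I] {p : Y → I} (hg : Measurable g)
    (hp : Measurable p) (n : ℕ) : Measurable (itinerary g p n) :=
  measurable_pi_lambda _ fun i => hp.comp (hg.iterate i.val)

lemma subadditive_partEntropy_itinerary [IsProbabilityMeasure ν] (hg : MeasurePreserving g ν ν)
    {p : Y → I} (hp : Measurable p) :
    Subadditive fun n => partEntropy ν (itinerary g p n) := by
  intro m n
  have hm := measurable_itinerary hg.measurable hp m
  have hn := measurable_itinerary hg.measurable hp n
  have hgm : Measurable g^[m] := hg.measurable.iterate m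
  have h1 : partEntropy ν (itinerary g p (m + n)) ≤
      partEntropy ν (fun y => (itinerary g p m y, itinerary g p n (g^[m] y))) := by
    refine partEntropy_le_of_determines (hm.prodMk (hn.comp hgm)) fun y z h => ?_
    rw [Prod.mk.injEq] at h
    funext i
    rcases lt_or_ge i.val m with hi | hi
    · exact congrFun h.1 ⟨i, hi⟩
    · have := congrFun h.2 ⟨i - m, by omega⟩
      simpa only [itinerary, ← Function.iterate_add_apply, Nat.sub_add_cancel hi] using this
  refine h1.trans ((partEntropy_prod_le hm (hn.comp hgm)).trans_eq ?_)
  exact congrArg _ (partEntropy_comp_measurePreserving (hg.iterate m) hn)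

lemma tendsto_partEntropy_itinerary [IsProbabilityMeasure ν] (hg : MeasurePreserving g ν ν)
    {p : Y → I} (hp : Measurable p) :
    Tendsto (fun n : ℕ => (n : ℝ)⁻¹ * partEntropy ν (itinerary g p n)) atTop
      (𝓝 (limsup (fun n : ℕ => (n : ℝ)⁻¹ * partEntropy ν (itinerary g p n)) atTop)) := by
  have h := (subadditive_partEntropy_itinerary hg hp).tendsto_lim
    ⟨0, by rintro _ ⟨n, rfl⟩; exact div_nonneg (partEntropy_nonneg _) n.cast_nonneg⟩
  simp only [div_eq_inv_mul] at h
  rwa [h.limsup_eq]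

lemma partEntropy_itinerary_prod_le [IsFiniteMeasure ν] (hg : MeasurePreserving g ν ν)
    {p : Y → I} {q : Y → J} (hp : Measurable p) (hq : Measurable q) (n : ℕ) :
    partEntropy ν (fun y => (itinerary g p n y, itinerary g q n y)) ≤
      partEntropy ν (itinerary g q n) +
        n * (partEntropy ν (fun y => (p y, q y)) - partEntropy ν q) := by
  induction n with
  | zero =>
    simpa using partEntropy_le_of_determines (measurable_itinerary hg.measurable hq 0)
      fun y z _ => Subsingleton.elim _ _
  | succ n ih =>
    have hA := measurable_itinerary hg.measurable hp n
    have hC := measurable_itinerary hg.measurable hq n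
    have hgn := hg.iterate n
    have hb : Measurable fun y => p (g^[n] y) := hp.comp hgn.measurable
    have hd : Measurable fun y => q (g^[n] y) := hq.comp hgn.measurable
    have s1 := partEntropy_submodular (ν := ν) hA hb fun y => (itinerary g q n y, q (g^[n] y))
    have s2 := partEntropy_submodular (ν := ν) hA hd (itinerary g q n)
    have s3 := partEntropy_submodular (ν := ν) hb hC fun y => q (g^[n] y)
    have e1 : partEntropy ν (fun y => (itinerary g p n y, itinerary g q n y, q (g^[n] y))) ≤
        partEntropy ν (fun y => (itinerary g p n y, q (g^[n] y), itinerary g q n y)) :=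
      partEntropy_le_of_determines (hA.prodMk (hd.prodMk hC)) (by simp +contextual)
    have e2 : partEntropy ν (fun y => (q (g^[n] y), itinerary g q n y)) ≤
        partEntropy ν (fun y => (itinerary g q n y, q (g^[n] y))) :=
      partEntropy_le_of_determines (hC.prodMk hd) (by simp +contextual)
    have e3 : partEntropy ν (fun y => (itinerary g p (n + 1) y, itinerary g q (n + 1) y)) ≤
        partEntropy ν (fun y =>
          (itinerary g p n y, p (g^[n] y), itinerary g q n y, q (g^[n] y))) := by
      refine partEntropy_le_of_determines (hA.prodMk (hb.prodMk (hC.prodMk hd)))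
        fun y z h => ?_
      simp only [Prod.mk.injEq] at h
      rw [itinerary_succ_eq h.1 h.2.1, itinerary_succ_eq h.2.2.1 h.2.2.2]
    have e4 : partEntropy ν (fun y => (itinerary g q n y, q (g^[n] y))) ≤
        partEntropy ν (itinerary g q (n + 1)) := by
      refine partEntropy_le_of_determines (measurable_itinerary hg.measurable hq _) fun y z h => ?_
      rw [Prod.mk.injEq]
      exact ⟨funext fun i => congrFun h i.castSucc, congrFun h (Fin.last n)⟩
    have i1 := partEntropy_comp_measurePreserving hgn (hp.prodMk hq)
    have i2 := partEntropy_comp_measurePreserving hgn hq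
    push_cast
    linarith

lemma partEntropy_itinerary_le [IsFiniteMeasure ν] (hg : MeasurePreserving g ν ν)
    {p : Y → I} {q : Y → J} (hp : Measurable p) (hq : Measurable q) (n : ℕ) :
    partEntropy ν (itinerary g p n) ≤ partEntropy ν (itinerary g q n) +
      n * (partEntropy ν (fun y => (p y, q y)) - partEntropy ν q) := by
  refine le_trans ?_ (partEntropy_itinerary_prod_le hg hp hq n)
  refine partEntropy_le_of_determines ((measurable_itinerary hg.measurable hp n).prodMk
    (measurable_itinerary hg.measurable hq n)) fun y z h => ?_
  exact congrArg Prod.fst h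

end Itinerary

section Cylinder

variable {X I : Type*} [MeasurableSpace X]

/-- A map on `X^ℕ` that only depends on finitely many coordinates, each of them read through one
finite measurable partition of `X`. -/
def IsCylinderMap (f : (ℕ → X) → I) : Prop :=
  ∃ (M : ℕ) (q : X → Fin M) (k : ℕ), Measurable q ∧
    ∀ y z, (∀ i < k, q (y i) = q (z i)) → f y = f z

lemma IsCylinderMap.of_finite {f : (ℕ → X) → I} {J : Type*} [Finite J] [MeasurableSpace J]
    [MeasurableSingletonClass J] {q : X → J} (hq : Measurable q) (k : ℕ)
    (h : ∀ y z, (∀ i < k, q (y i) = q (z i)) → f y = f z) : IsCylinderMap f := by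
  obtain ⟨M, ⟨e⟩⟩ := Finite.exists_equiv_fin J
  exact ⟨M, e ∘ q, k, (measurable_of_finite e).comp hq, fun y z hyz =>
    h y z fun i hi => e.injective (hyz i hi)⟩

lemma IsCylinderMap.measurable [MeasurableSpace I] {f : (ℕ → X) → I} (hf : IsCylinderMap f) :
    Measurable f := by
  obtain ⟨M, q, k, hq, h⟩ := hf
  rcases isEmpty_or_nonempty (ℕ → X) with hX | ⟨⟨y₀⟩⟩
  · exact measurable_of_empty f
  · set R : (ℕ → X) → Fin k → Fin M := fun y i => q (y i)
    have hR : Measurable R := by fun_prop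
    have : f = Function.extend R f (fun _ => f y₀) ∘ R := by
      ext1 y
      refine (Function.FactorsThrough.extend_apply (fun y z hyz => h y z fun i hi => ?_) _ y).symm
      exact congrFun hyz ⟨i, hi⟩
    rw [this]
    exact (measurable_of_finite _).comp hR

lemma IsCylinderMap.comp {K : Type*} {f : (ℕ → X) → I} (hf : IsCylinderMap f) (G : I → K) :
    IsCylinderMap fun y => G (f y) := by
  obtain ⟨M, q, k, hq, h⟩ := hf
  exact ⟨M, q, k, hq, fun y z hyz => congrArg G (h y z hyz)⟩

lemma IsCylinderMap.pi {ι : Type*} [Fintype ι] {f : ι → (ℕ → X) → I}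
    (hf : ∀ i, IsCylinderMap (f i)) : IsCylinderMap fun y i => f i y := by
  choose M q k hq h using hf
  refine .of_finite (measurable_pi_lambda (fun x i => q i x) hq) (Finset.univ.sup k)
    fun y z hyz => funext fun i => h i y z fun j hj => ?_
  exact congrFun (hyz j (hj.trans_le (Finset.le_sup (Finset.mem_univ i)))) i

lemma isCylinderMap_mem_eval_preimage (k : ℕ) {s : Set X} (hs : MeasurableSet s) :
    IsCylinderMap fun y : ℕ → X => y ∈ Function.eval k ⁻¹' s :=
  .of_finite (q := fun x => x ∈ s) hs.mem (k + 1) fun _ _ h => h k k.lt_succ_self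

lemma isSetAlgebra_isCylinderMap_mem :
    IsSetAlgebra {S : Set (ℕ → X) | IsCylinderMap (· ∈ S)} where
  empty_mem := ⟨1, fun _ => 0, 0, measurable_const, fun _ _ _ => rfl⟩
  compl_mem _ hS := hS.comp Not
  union_mem S T hS hT :=
    (IsCylinderMap.pi (f := fun b : Bool => if b then (· ∈ S) else (· ∈ T))
      (by rintro (_ | _) <;> assumption)).comp fun P => P true ∨ P false

lemma pi_eq_generateFrom_isCylinderMap_mem :
    (MeasurableSpace.pi : MeasurableSpace (ℕ → X)) =
      MeasurableSpace.generateFrom {S | IsCylinderMap (· ∈ S)} := by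
  refine le_antisymm (iSup_le fun k => ?_) (MeasurableSpace.generateFrom_le fun S hS => ?_)
  · rintro _ ⟨s, hs, rfl⟩
    exact MeasurableSpace.measurableSet_generateFrom (isCylinderMap_mem_eval_preimage k hs)
  · exact measurableSet_setOfPred.2 (IsCylinderMap.measurable hS)

lemma exists_isCylinderMap_measureReal_ne_lt [Fintype I] [MeasurableSpace I]
    [MeasurableSingletonClass I] {ν : Measure (ℕ → X)} [IsProbabilityMeasure ν]
    {p : (ℕ → X) → I} (hp : Measurable p) {δ : ℝ} (hδ : 0 < δ) :
    ∃ p' : (ℕ → X) → I, IsCylinderMap p' ∧ ν.real {y | p y ≠ p' y} < δ := by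
  have hne : Nonempty I := (nonempty_of_isProbabilityMeasure ν).map p
  set δ' : ℝ := δ / (Fintype.card I + 1) with hδ'
  have hpos : 0 < δ' := by positivity
  have happrox : ∀ i, ∃ S : Set (ℕ → X), IsCylinderMap (· ∈ S) ∧
      ν (symmDiff S (p ⁻¹' {i})) < ENNReal.ofReal δ' := fun i =>
    exists_measure_symmDiff_lt_of_generateFrom_isSetRing isSetAlgebra_isCylinderMap_mem.isSetRing
      ⟨{univ}, countable_singleton _,
        singleton_subset_iff.2 isSetAlgebra_isCylinderMap_mem.univ_mem, by simp⟩
      pi_eq_generateFrom_isCylinderMap_mem (hp (measurableSet_singleton i))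
      (ENNReal.ofReal_pos.2 hpos)
  choose S hS hSδ using happrox
  set e : I → I → Prop := fun j i => j = i with he
  have hinj : Function.Injective e := fun j j' h => ((congrFun h j').mpr rfl : e j j')
  refine ⟨fun y => Function.invFun e fun i => y ∈ S i,
    (IsCylinderMap.pi hS).comp (Function.invFun e), ?_⟩
  have hsub : {y | p y ≠ Function.invFun e fun i => y ∈ S i} ⊆
      ⋃ i, symmDiff (S i) (p ⁻¹' {i}) := by
    intro y hy
    by_contra hcon
    refine hy ?_
    have : (fun i => y ∈ S i) = e (p y) := by
      funext i
      have hi : y ∉ symmDiff (S i) (p ⁻¹' {i}) := fun h => hcon (mem_iUnion.2 ⟨i, h⟩)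
      simp only [mem_symmDiff, mem_preimage, mem_singleton_iff] at hi
      simp only [he, eq_iff_iff]
      tauto
    rw [this, Function.leftInverse_invFun hinj]
  calc ν.real _ ≤ ν.real (⋃ i, symmDiff (S i) (p ⁻¹' {i})) := measureReal_mono hsub
    _ ≤ ∑ i, ν.real (symmDiff (S i) (p ⁻¹' {i})) := measureReal_iUnion_fintype_le _
    _ ≤ ∑ _i : I, δ' := Finset.sum_le_sum fun i _ =>
        ENNReal.toReal_le_of_le_ofReal hpos.le (hSδ i).le
    _ = Fintype.card I * δ' := by simp
    _ < (Fintype.card I + 1) * δ' := by linarith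
    _ = δ := by rw [hδ']; field_simp

end Cylinder

section Trajectory

open ProbabilityTheory

variable {X : Type*}

lemma iterate_shiftSeq (y : ℕ → X) (n k : ℕ) : shiftSeq^[n] y k = y (k + n) := by
  induction n generalizing y with
  | zero => rfl
  | succ n ih => rw [Function.iterate_succ_apply, ih]; rfl

variable [MeasurableSpace X]

lemma measurable_map_prodMk {A Z : Type*} [MeasurableSpace A] [MeasurableSpace Z]
    {κ : A → Measure X} (hκ : Measurable κ) (hκ' : ∀ x, IsProbabilityMeasure (κ x))
    {F : A × X → Z} (hF : Measurable F) :
    Measurable fun x => (κ x).map fun y => F (x, y) := by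
  let κ' : Kernel A X := ⟨κ, hκ⟩
  have : IsMarkovKernel κ' := ⟨hκ'⟩
  refine Measure.measurable_of_measurable_coe _ fun s hs => ?_
  have h : ∀ x, (κ x).map (fun y => F (x, y)) s = κ' x (Prod.mk x ⁻¹' (F ⁻¹' s)) := fun x =>
    Measure.map_apply (by fun_prop) hs
  simp only [h]
  exact Kernel.measurable_kernel_prodMk_left (hF hs)

lemma measurable_snoc (n : ℕ) :
    Measurable fun p : (Fin n → X) × X => (Fin.snoc p.1 p.2 : Fin (n + 1) → X) := by
  refine measurable_pi_lambda _ fun i => ?_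
  refine Fin.lastCases ?_ (fun j => ?_) i
  · simpa using measurable_snd
  · simp only [Fin.snoc_castSucc]
    fun_prop

lemma measurable_markovStep {Q : X → Measure X} (hQ : IsTransKernel Q) (n : ℕ) :
    Measurable fun x : Fin (n + 1) → X =>
      (Q (x (Fin.last n))).map fun y => (Fin.snoc x y : Fin (n + 2) → X) :=
  measurable_map_prodMk (hQ.1.comp (measurable_pi_apply _)) (fun _ => hQ.2 _) (measurable_snoc _)

lemma map_bind {A B Z : Type*} [MeasurableSpace A] [MeasurableSpace B] [MeasurableSpace Z]
    {m : Measure A} {κ : A → Measure B} (hκ : Measurable κ) {f : B → Z} (hf : Measurable f) :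
    (m.bind κ).map f = m.bind fun x => (κ x).map f := by
  have h : Measurable fun x => (κ x).map f := (Measure.measurable_map f hf).comp hκ
  ext s hs
  rw [Measure.map_apply hf hs, Measure.bind_apply (hf hs) hκ.aemeasurable,
    Measure.bind_apply hs h.aemeasurable]
  simp only [Measure.map_apply hf hs]

lemma bind_map {A B Z : Type*} [MeasurableSpace A] [MeasurableSpace B] [MeasurableSpace Z]
    {m : Measure A} {f : A → B} (hf : Measurable f) {κ : B → Measure Z} (hκ : Measurable κ) :
    (m.map f).bind κ = m.bind fun x => κ (f x) := by
  rw [Measure.bind, Measure.map_map hκ hf]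
  rfl

lemma measurable_tail (n : ℕ) :
    Measurable (Fin.tail : (Fin (n + 1) → X) → Fin n → X) := by
  unfold Fin.tail
  fun_prop

lemma map_tail_markovLaw {Q : X → Measure X} (hQ : IsTransKernel Q) {μ : Measure X}
    (hinv : μ.bind Q = μ) (n : ℕ) :
    (markovLaw μ Q (n + 1)).map Fin.tail = markovLaw μ Q n := by
  induction n with
  | zero =>
    have hc : Measurable fun (x : X) (_ : Fin 1) => x := by fun_prop
    have hs := measurable_markovStep hQ 0
    simp only [markovLaw]
    have h : Measurable fun x : Fin 1 → X => ((Q (x (Fin.last 0))).map fun y =>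
        (Fin.snoc x y : Fin 2 → X)).map Fin.tail :=
      (Measure.measurable_map _ (measurable_tail 1)).comp hs
    rw [map_bind hs (measurable_tail 1), bind_map hc h]
    conv_rhs => rw [← hinv, map_bind hQ.1 hc]
    congr 1
    funext x
    have hsn : Measurable fun y : X => (Fin.snoc (fun _ : Fin 1 => x) y : Fin 2 → X) :=
      (measurable_snoc 1).comp (measurable_prodMk_left (x := fun _ : Fin 1 => x))
    rw [Measure.map_map (measurable_tail 1) hsn]
    congr 1
  | succ n ih =>
    have hs := measurable_markovStep hQ n
    have ht := measurable_tail (X := X) (n + 1)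
    rw [markovLaw, map_bind (measurable_markovStep hQ (n + 1)) (measurable_tail _)]
    conv_rhs => rw [markovLaw, ← ih, bind_map ht hs]
    congr 1
    funext x
    have hsn : Measurable fun y : X => (Fin.snoc x y : Fin (n + 3) → X) :=
      (measurable_snoc _).comp measurable_prodMk_left
    rw [Measure.map_map (measurable_tail _) hsn]
    change _ = (Q (x (Fin.last (n + 1)))).map _
    congr 1
    funext y i
    refine Fin.lastCases ?_ (fun j => ?_) i
    · simp only [Function.comp_apply, Fin.tail, Fin.succ_last, Fin.snoc_last]
    · simp only [Function.comp_apply, Fin.tail, Fin.succ_castSucc, Fin.snoc_castSucc]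

lemma measurable_shiftSeq : Measurable (shiftSeq : (ℕ → X) → ℕ → X) := by
  unfold shiftSeq
  fun_prop

lemma ext_of_map_initial {ν ν' : Measure (ℕ → X)} [IsFiniteMeasure ν]
    (h : ∀ n : ℕ, ν'.map (fun x (i : Fin (n + 1)) => x i.val) =
      ν.map (fun x (i : Fin (n + 1)) => x i.val)) : ν' = ν := by
  refine IsProjectiveLimit.unique (P := fun I : Finset ℕ => ν.map I.restrict) (fun I => ?_)
    fun I => rfl
  obtain ⟨N, hN⟩ : ∃ N, ∀ i ∈ I, i < N + 1 :=
    ⟨I.sup id, fun i hi => Nat.lt_succ_of_le (Finset.le_sup (f := id) hi)⟩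
  have hr : (I.restrict : (ℕ → X) → I → X) =
      (fun (z : Fin (N + 1) → X) (i : I) => z ⟨i, hN i i.2⟩) ∘
        fun x (i : Fin (N + 1)) => x i.val := rfl
  rw [hr, ← Measure.map_map (by fun_prop) (by fun_prop), h, Measure.map_map (by fun_prop)
    (by fun_prop)]
  rfl

lemma IsTrajLaw.measurePreserving_shiftSeq {Q : X → Measure X} (hQ : IsTransKernel Q)
    {μ : Measure X} (hinv : μ.bind Q = μ) {ν : Measure (ℕ → X)} (hν : IsTrajLaw μ Q ν) :
    MeasurePreserving shiftSeq ν ν := by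
  have := hν.1
  refine ⟨measurable_shiftSeq, ext_of_map_initial fun n => ?_⟩
  rw [Measure.map_map (by fun_prop) measurable_shiftSeq, hν.2 n, ← map_tail_markovLaw hQ hinv n,
    ← hν.2 (n + 1), Measure.map_map (measurable_tail _) (by fun_prop)]
  rfl

lemma IsTrajLaw.partEntropy_markovLaw {Q : X → Measure X} {μ : Measure X} {ν : Measure (ℕ → X)}
    (hν : IsTrajLaw μ Q ν) {M : ℕ} {q : X → Fin M} (hq : Measurable q) (n : ℕ) :
    (n : ℝ)⁻¹ * partEntropy (markovLaw μ Q (n - 1)) (fun x => q ∘ x) =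
      (n : ℝ)⁻¹ * partEntropy ν (itinerary shiftSeq (fun y => q (y 0)) n) := by
  rcases n with _ | n
  · simp
  · have hq' : Measurable fun x : Fin (n + 1) → X => q ∘ x :=
      measurable_pi_lambda _ fun i => hq.comp (measurable_pi_apply i)
    rw [Nat.add_sub_cancel, ← hν.2, partEntropy_map (by fun_prop) hq']
    congr 2
    funext y i
    simp [itinerary, iterate_shiftSeq]

lemma exists_limsup_itinerary_le {ν : Measure (ℕ → X)} [IsProbabilityMeasure ν]
    (hg : MeasurePreserving shiftSeq ν ν) {I : Type*} [Fintype I] [MeasurableSpace I]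
    [MeasurableSingletonClass I] {p : (ℕ → X) → I} (hp : Measurable p) {ε : ℝ} (hε : 0 < ε) :
    ∃ (M : ℕ) (q : X → Fin M), Measurable q ∧
      limsup (fun n : ℕ => (n : ℝ)⁻¹ * partEntropy ν (itinerary shiftSeq p n)) atTop ≤
      limsup (fun n : ℕ => (n : ℝ)⁻¹ *
        partEntropy ν (itinerary shiftSeq (fun y => q (y 0)) n)) atTop + ε := by
  obtain ⟨δ₁, hδ₁, h₁⟩ := exists_forall_abs_partEntropy_sub_lt (ν := ν) hp (half_pos hε)
  obtain ⟨δ₂, hδ₂, h₂⟩ :=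
    exists_forall_abs_partEntropy_sub_lt (ν := ν) (hp.prodMk hp) (half_pos hε)
  obtain ⟨p', hcyl, hδ⟩ :=
    exists_isCylinderMap_measureReal_ne_lt (ν := ν) hp (lt_min hδ₁ hδ₂)
  have hp' := hcyl.measurable
  have hc : partEntropy ν (fun y => (p y, p' y)) - partEntropy ν p' ≤ ε := by
    have i1 := h₁ p' hp' (hδ.trans_le (min_le_left _ _))
    have i2 := h₂ (fun y => (p y, p' y)) (hp.prodMk hp')
      (by simpa using hδ.trans_le (min_le_right _ _))
    have i3 : partEntropy ν (fun y => (p y, p y)) ≤ partEntropy ν p :=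
      partEntropy_le_of_determines hp fun y z h => by rw [h]
    rw [abs_lt] at i1 i2
    linarith
  obtain ⟨M, q, k, hq, hfac⟩ := hcyl
  have hq0 : Measurable fun y : ℕ → X => q (y 0) := hq.comp (measurable_pi_apply 0)
  refine ⟨M, q, hq, ?_⟩
  set C := partEntropy ν (itinerary shiftSeq (fun y => q (y 0)) k)
  have hlim := ((tendsto_partEntropy_itinerary hg hq0).add
    ((tendsto_inv_atTop_nhds_zero_nat (𝕜 := ℝ)).mul_const C)).add_const ε
  rw [zero_mul, add_zero] at hlim
  refine le_of_tendsto_of_tendsto (tendsto_partEntropy_itinerary hg hp) hlim ?_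
  filter_upwards [eventually_gt_atTop 0] with n hn
  have e1 := partEntropy_itinerary_le hg hp hp' n
  have e2 : partEntropy ν (itinerary shiftSeq p' n) ≤
      partEntropy ν (itinerary shiftSeq (fun y => q (y 0)) (n + k)) := by
    refine partEntropy_le_of_determines (measurable_itinerary hg.measurable hq0 _) fun y z h =>
      funext fun i => hfac _ _ fun j hj => ?_
    have := congrFun h ⟨j + i, by omega⟩
    simpa [itinerary, iterate_shiftSeq] using this
  have e3 := subadditive_partEntropy_itinerary hg hq0 n k
  have hn' : (0 : ℝ) < n := Nat.cast_pos.2 hn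
  have e4 := mul_le_mul_of_nonneg_left hc hn'.le
  calc (n : ℝ)⁻¹ * partEntropy ν (itinerary shiftSeq p n)
      ≤ (n : ℝ)⁻¹ * (partEntropy ν (itinerary shiftSeq (fun y => q (y 0)) n) + C + n * ε) := by
        gcongr
        linarith
    _ = _ := by field_simp

end Trajectory

/-- The measure-theoretic entropy of a transition probability kernel equals the
Kolmogorov–Sinai entropy of the shift on `X^ℕ` w.r.t. the trajectory law `μQ^ω`
(which is shift-invariant). -/
theorem kernel_entropy_eq_shift_entropy
    {X : Type*} [MeasurableSpace X]
    (Q : X → Measure X) (hQ : IsTransKernel Q)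
    (μ : Measure X) (hμ : IsProbabilityMeasure μ) (hinv : μ.bind Q = μ)
    (ν : Measure (ℕ → X)) (hν : IsTrajLaw μ Q ν) :
    ν.map shiftSeq = ν ∧ kernelEntropy μ Q = ksEntropy ν shiftSeq := by
  have hg := hν.measurePreserving_shiftSeq hQ hinv
  have := hν.1
  have hker : ∀ (M : ℕ) (q : X → Fin M) (_ : Measurable q),
      limsup (fun n : ℕ => (n : ℝ)⁻¹ * partEntropy (markovLaw μ Q (n - 1)) fun x => q ∘ x) atTop =
        limsup (fun n : ℕ => (n : ℝ)⁻¹ *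
          partEntropy ν (itinerary shiftSeq (fun y => q (y 0)) n)) atTop :=
    fun M q hq => congrArg (limsup · atTop) (funext (hν.partEntropy_markovLaw hq))
  refine ⟨hg.map_eq, le_antisymm ?_ ?_⟩
  · refine iSup_le fun M => iSup_le fun q => iSup_le fun hq => ?_
    rw [hker M q hq]
    exact le_iSup_of_le M (le_iSup_of_le (fun y => q (y 0))
      (le_iSup_of_le (hq.comp (measurable_pi_apply 0)) le_rfl))
  · refine iSup_le fun m => iSup_le fun p => iSup_le fun hp => ?_
    by_contra! hlt
    obtain ⟨r, hr, hrp⟩ := EReal.lt_iff_exists_real_btwn.1 hlt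
    obtain ⟨M, q, hq, hle⟩ :=
      exists_limsup_itinerary_le hg hp (sub_pos.2 (EReal.coe_lt_coe_iff.1 hrp))
    have hqr : ((limsup (fun n : ℕ => (n : ℝ)⁻¹ *
        partEntropy (markovLaw μ Q (n - 1)) fun x => q ∘ x) atTop : ℝ) : EReal) < r := by
      refine lt_of_le_of_lt ?_ hr
      exact le_iSup_of_le M (le_iSup_of_le q (le_iSup_of_le hq le_rfl))
    rw [hker M q hq, EReal.coe_lt_coe_iff] at hqr
    have h := hle.trans_lt (add_lt_add_left hqr _)
    rw [add_sub_cancel] at h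
    exact lt_irrefl _ h

end Corr
end

section
/- Separated-set pressure equals spanning-set pressure for correspondences: Let T be a correspondence on a compact metric space (X,d) and φ : O₂(T) → ℝ a continuous function. Then lim_{ε→0⁺} limsup_{n→∞} (1/n)·log( sup_E Σ_{x∈E} exp(S_nφ(x)) ) = lim_{ε→0⁺} limsup_{n→∞} (1/n)·log( inf_F Σ_{x∈F} exp(S_nφ(x)) ), where E ranges over all ε-separated subsets and F ranges over all ε-spanning subsets of (O_{n+1}(T), d_{n+1}); in particular both outer limits in ε exist (in [−∞,+∞]) since the inner quantities are monotone in ε. -/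
open Filter MeasureTheory Set
open scoped Topology ENNReal Classical

namespace Corr

lemma scaled_elog_mono (n : ℕ) {a b : ℝ≥0∞} (h : a ≤ b) :
    (((n : ℝ)⁻¹ : ℝ) : EReal) * elog a ≤ (((n : ℝ)⁻¹ : ℝ) : EReal) * elog b :=
  mul_le_mul_of_nonneg_left (elog_mono h) (EReal.coe_nonneg.2 (by positivity))

lemma elog_ofReal_exp_mul (c : ℝ) (x : ℝ≥0∞) :
    elog (ENNReal.ofReal (Real.exp c) * x) = (c : EReal) + elog x := by
  rw [elog_eq_log, ENNReal.log_mul_add, ENNReal.log_ofReal_of_pos (Real.exp_pos c), Real.log_exp,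
    elog_eq_log]

lemma eSep.mono {Y : Type*} [PseudoMetricSpace Y] {ε ε' : ℝ} (h : ε ≤ ε') {E : Set Y}
    (hE : eSep ε' E) : eSep ε E :=
  fun x hx y hy hxy => h.trans (hE x hx y hy hxy)

lemma exists_subset_eSep_spanning {Y : Type*} [PseudoMetricSpace Y] {ε : ℝ} (hε : 0 < ε)
    (S : Set Y) : ∃ E ⊆ S, eSep ε E ∧ ∀ y ∈ S, ∃ x ∈ E, dist x y < ε := by
  obtain ⟨E, hE⟩ := zorn_subset {E : Set Y | E ⊆ S ∧ eSep ε E} (by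
    intro c hc hchain
    refine ⟨⋃₀ c, ⟨sUnion_subset fun s hs => (hc hs).1, ?_⟩, fun s hs => subset_sUnion_of_mem hs⟩
    rintro x ⟨s, hs, hxs⟩ y ⟨t, ht, hyt⟩ hxy
    rcases hchain.total hs ht with h | h
    · exact (hc ht).2 x (h hxs) y hyt hxy
    · exact (hc hs).2 x hxs y (h hyt) hxy)
  refine ⟨E, hE.prop.1, hE.prop.2, fun y hy => ?_⟩
  by_contra! hfar
  have hins : insert y E ∈ {E : Set Y | E ⊆ S ∧ eSep ε E} := by
    refine ⟨insert_subset hy hE.prop.1, ?_⟩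
    rintro a (rfl | ha) b (rfl | hb) hab
    · exact absurd rfl hab
    · rw [dist_comm]
      exact hfar b hb
    · exact hfar a ha
    · exact hE.prop.2 a ha b hb hab
  have := hfar y (hE.le_of_ge hins (subset_insert y E) (mem_insert y E))
  rw [dist_self] at this
  exact this.not_gt hε

section Pressure

variable {X : Type*} [MetricSpace X] (T : X → Set X) (φ : ↥(graph2 T) → ℝ)

lemma spanInf_le_sepSup (n : ℕ) {ε : ℝ} (hε : 0 < ε) : spanInf T φ n ε ≤ sepSup T φ n ε := by
  obtain ⟨E, hES, hsep, hspan⟩ := exists_subset_eSep_spanning hε (finOrbits T n)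
  calc spanInf T φ n ε ≤ orbSum T φ n E :=
        iInf_le_of_le E (iInf₂_le (f := fun _ _ => orbSum T φ n E) hES hspan)
    _ ≤ sepSup T φ n ε :=
        le_iSup_of_le E (le_iSup₂ (f := fun _ _ => orbSum T φ n E) hES hsep)

lemma sepSup_antitone (n : ℕ) : Antitone (sepSup T φ n) := fun _ _ h =>
  iSup_mono fun _ => iSup_mono fun _ => iSup_mono' fun hE => ⟨hE.mono h, le_rfl⟩

lemma spanInf_antitone (n : ℕ) : Antitone (spanInf T φ n) := fun _ _ h =>
  iInf_mono fun _ => iInf_mono fun _ => iInf_mono' fun hE =>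
    ⟨fun y hy => (hE y hy).imp fun _ hx => ⟨hx.1, hx.2.trans_le h⟩, le_rfl⟩

lemma pressSepEps_antitone : Antitone (pressSepEps T φ) := fun _ _ h =>
  limsup_le_limsup (Eventually.of_forall fun n => scaled_elog_mono n (sepSup_antitone T φ n h))

lemma pressSpanEps_antitone : Antitone (pressSpanEps T φ) := fun _ _ h =>
  limsup_le_limsup (Eventually.of_forall fun n => scaled_elog_mono n (spanInf_antitone T φ n h))

lemma pressSpanEps_le_pressSepEps {ε : ℝ} (hε : 0 < ε) :
    pressSpanEps T φ ε ≤ pressSepEps T φ ε :=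
  limsup_le_limsup (Eventually.of_forall fun n =>
    scaled_elog_mono n (spanInf_le_sepSup T φ n hε))

variable {T φ}

lemma birkhoff_le_add {ε δ : ℝ} (hφ : ∀ a b : ↥(graph2 T), dist a b < ε → |φ a - φ b| ≤ δ)
    {n : ℕ} {x y : Fin (n + 1) → X} (hx : x ∈ finOrbits T n) (hy : y ∈ finOrbits T n)
    (hxy : dist x y < ε) : birkhoff T φ x ≤ n * δ + birkhoff T φ y := by
  have hterm : ∀ i : Fin n, ext2 T φ (x i.castSucc, x i.succ) ≤
      δ + ext2 T φ (y i.castSucc, y i.succ) := fun i => by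
    have hxi : (x i.castSucc, x i.succ) ∈ graph2 T := hx i
    have hyi : (y i.castSucc, y i.succ) ∈ graph2 T := hy i
    rw [ext2, ext2, dif_pos hxi, dif_pos hyi]
    have hdist : dist (⟨_, hxi⟩ : ↥(graph2 T)) ⟨_, hyi⟩ < ε :=
      (max_le (dist_le_pi_dist x y _) (dist_le_pi_dist x y _)).trans_lt hxy
    linarith [(abs_le.1 (hφ _ _ hdist)).2]
  calc birkhoff T φ x ≤ ∑ i : Fin n, (δ + ext2 T φ (y i.castSucc, y i.succ)) :=
        Finset.sum_le_sum fun i _ => hterm i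
    _ = n * δ + birkhoff T φ y := by simp [Finset.sum_add_distrib, birkhoff]

lemma sepSup_le_exp_mul_spanInf {ε δ : ℝ}
    (hφ : ∀ a b : ↥(graph2 T), dist a b < ε → |φ a - φ b| ≤ δ) (n : ℕ) :
    sepSup T φ n (2 * ε) ≤ ENNReal.ofReal (Real.exp (n * δ)) * spanInf T φ n ε := by
  have hc0 : ENNReal.ofReal (Real.exp (n * δ)) ≠ 0 := by
    simpa using Real.exp_pos _
  simp only [spanInf, ENNReal.mul_iInf_of_ne hc0 ENNReal.ofReal_ne_top]
  refine iSup_le fun E => iSup_le fun hES => iSup_le fun hsep =>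
    le_iInf fun F => le_iInf fun hFS => le_iInf fun hspan => ?_
  choose f hfF hfdist using fun x : E => hspan x (hES x.2)
  let g : E → F := fun x => ⟨f x, hfF x⟩
  have hg : Function.Injective g := fun x y hxy => by
    by_contra hne
    have hfxy : f x = f y := congrArg Subtype.val hxy
    have hle := hsep x x.2 y y.2 fun h => hne (Subtype.ext h)
    have hx := hfdist x
    rw [hfxy] at hx
    linarith [dist_triangle_left (x : Fin (n + 1) → X) y (f y), hfdist y]
  calc orbSum T φ n E
      ≤ ∑' x : E, ENNReal.ofReal (Real.exp (n * δ)) *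
          ENNReal.ofReal (Real.exp (birkhoff T φ (g x : Fin (n + 1) → X))) := by
        refine ENNReal.tsum_le_tsum fun x => ?_
        rw [← ENNReal.ofReal_mul (Real.exp_pos _).le, ← Real.exp_add]
        refine ENNReal.ofReal_le_ofReal (Real.exp_le_exp.2 ?_)
        exact birkhoff_le_add hφ (hES x.2) (hFS (hfF x)) (by rw [dist_comm]; exact hfdist x)
    _ = ENNReal.ofReal (Real.exp (n * δ)) *
          ∑' x : E, ENNReal.ofReal (Real.exp (birkhoff T φ (g x : Fin (n + 1) → X))) :=
        ENNReal.tsum_mul_left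
    _ ≤ ENNReal.ofReal (Real.exp (n * δ)) * orbSum T φ n F :=
        mul_le_mul_right (ENNReal.tsum_comp_le_tsum_of_injective hg
          fun y : F => ENNReal.ofReal (Real.exp (birkhoff T φ (y : Fin (n + 1) → X)))) _

lemma pressSepEps_le_add_pressSpanEps {ε δ : ℝ}
    (hφ : ∀ a b : ↥(graph2 T), dist a b < ε → |φ a - φ b| ≤ δ) :
    pressSepEps T φ (2 * ε) ≤ (δ : EReal) + pressSpanEps T φ ε := by
  have hbound : ∀ᶠ n : ℕ in atTop,
      (((n : ℝ)⁻¹ : ℝ) : EReal) * elog (sepSup T φ n (2 * ε)) ≤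
        (δ : EReal) + (((n : ℝ)⁻¹ : ℝ) : EReal) * elog (spanInf T φ n ε) := by
    filter_upwards [eventually_gt_atTop 0] with n hn
    have hn0 : (n : ℝ) ≠ 0 := by exact_mod_cast hn.ne'
    refine (scaled_elog_mono n (sepSup_le_exp_mul_spanInf hφ n)).trans_eq ?_
    rw [elog_ofReal_exp_mul, EReal.left_distrib_of_nonneg_of_ne_top
      (EReal.coe_nonneg.2 (by positivity)) (EReal.coe_ne_top _), ← EReal.coe_mul,
      inv_mul_cancel_left₀ hn0]
  refine (limsup_le_limsup hbound).trans ?_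
  refine (EReal.limsup_add_le (u := fun _ : ℕ => (δ : EReal)) ?_ ?_).trans_eq ?_
  · simp
  · simp
  · rw [limsup_const, pressSpanEps]

end Pressure

lemma ereal_le_of_forall_pos_le_coe_add {a b : EReal}
    (h : ∀ δ : ℝ, 0 < δ → a ≤ (δ : EReal) + b) : a ≤ b := by
  refine EReal.le_of_forall_lt_iff_le.1 fun z hz => ?_
  obtain ⟨w, hbw, hwz⟩ := EReal.lt_iff_exists_real_btwn.1 hz
  have hwz' : w < z := EReal.coe_lt_coe_iff.1 hwz
  calc a ≤ ((z - w : ℝ) : EReal) + b := h _ (sub_pos.2 hwz')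
    _ ≤ ((z - w : ℝ) : EReal) + w := by gcongr
    _ = z := by rw [← EReal.coe_add, sub_add_cancel]

/-- Separated-set pressure equals spanning-set pressure: both outer limits (as
`ε → 0⁺`) exist in `[-∞,+∞]` and are equal. -/
theorem sep_pressure_eq_span_pressure
    {X : Type*} [MetricSpace X] [CompactSpace X]
    (T : X → Set X) (hT : IsCorrespondence T) (φ : ↥(graph2 T) → ℝ) (hφ : Continuous φ) :
    ∃ P : EReal,
      Tendsto (fun ε : ℝ => pressSepEps T φ ε) (𝓝[>] (0 : ℝ)) (𝓝 P) ∧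
      Tendsto (fun ε : ℝ => pressSpanEps T φ ε) (𝓝[>] (0 : ℝ)) (𝓝 P) := by
  have hclosed : IsClosed (graph2 T) := hT.2.2
  have : CompactSpace ↥(graph2 T) := isCompact_iff_compactSpace.1 hclosed.isCompact
  have huc := Metric.uniformContinuous_iff.1 (CompactSpace.uniformContinuous_of_continuous hφ)
  have hsep := (pressSepEps_antitone T φ).tendsto_nhdsGT (0 : ℝ)
  have hspan := (pressSpanEps_antitone T φ).tendsto_nhdsGT (0 : ℝ)
  have heq : sSup (pressSepEps T φ '' Ioi 0) = sSup (pressSpanEps T φ '' Ioi 0) := by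
    refine le_antisymm (sSup_le ?_) (sSup_le ?_)
    · rintro _ ⟨ε, hε, rfl⟩
      refine ereal_le_of_forall_pos_le_coe_add fun δ hδ => ?_
      obtain ⟨η, hη, hmod⟩ := huc δ hδ
      have hpos : 0 < min η (ε / 2) := lt_min hη (half_pos hε)
      have hle : 2 * min η (ε / 2) ≤ ε := by linarith [min_le_right η (ε / 2)]
      calc pressSepEps T φ ε ≤ pressSepEps T φ (2 * min η (ε / 2)) := pressSepEps_antitone T φ hle
        _ ≤ (δ : EReal) + pressSpanEps T φ (min η (ε / 2)) :=
          pressSepEps_le_add_pressSpanEps fun a b hab =>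
            (hmod (hab.trans_le (min_le_left _ _))).le
        _ ≤ (δ : EReal) + sSup (pressSpanEps T φ '' Ioi 0) := by
          gcongr
          exact le_sSup (mem_image_of_mem _ hpos)
    · rintro _ ⟨ε, hε, rfl⟩
      exact (pressSpanEps_le_pressSepEps T φ hε).trans (le_sSup (mem_image_of_mem _ hε))
  exact ⟨_, hsep, heq ▸ hspan⟩

end Corr
end

section
/- Pressure of the inverse correspondence: Let T be a correspondence on a compact metric space (X,d) with T(X) = X (i.e., ∪_{x∈X} T(x) = X). Then T^{−1}, defined by T^{−1}(x) := {y ∈ X : x ∈ T(y)}, is again a correspondence on X, and for every continuous function φ : O₂(T) → ℝ one has P(T,φ) = P(T^{−1}, φ̄), where φ̄ : O₂(T^{−1}) → ℝ is defined by φ̄(x,y) := φ(y,x). -/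
open Filter MeasureTheory Set
open scoped Topology ENNReal Classical

namespace Corr

theorem isFinOrbit_comp_rev {X : Type*} {T T' : X → Set X}
    (h : ∀ x y, y ∈ T x → x ∈ T' y) {n : ℕ} {x : Fin (n + 1) → X} (hx : IsFinOrbit T x) :
    IsFinOrbit T' (x ∘ Fin.rev) := by
  intro i
  simpa only [Function.comp_apply, Fin.rev_succ, Fin.rev_castSucc] using h _ _ (hx i.rev)

theorem birkhoff_comp_rev {X : Type*} {T T' : X → Set X}
    {φ : ↥(graph2 T) → ℝ} {φ' : ↥(graph2 T') → ℝ}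
    (h : ∀ x y, ext2 T φ (x, y) = ext2 T' φ' (y, x)) {n : ℕ} (x : Fin (n + 1) → X) :
    birkhoff T' φ' (x ∘ Fin.rev) = birkhoff T φ x := by
  unfold birkhoff
  rw [← Equiv.sum_comp Fin.revPerm]
  refine Finset.sum_congr rfl fun i _ => ?_
  simp [h, Fin.rev_succ, Fin.rev_castSucc]

theorem eSep_image_comp_rev {X : Type*} [MetricSpace X] {n : ℕ} {ε : ℝ}
    {E : Set (Fin (n + 1) → X)} (hE : eSep ε E) : eSep ε ((· ∘ Fin.rev) '' E) := by
  rintro _ ⟨x, hx, rfl⟩ _ ⟨y, hy, rfl⟩ hne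
  refine (hE x hx y hy fun hxy => hne (by rw [hxy])).trans ?_
  refine (dist_pi_le_iff dist_nonneg).2 fun i => ?_
  simpa using dist_le_pi_dist (x ∘ Fin.rev) (y ∘ Fin.rev) i.rev

theorem orbSum_image_comp_rev {X : Type*} {T T' : X → Set X}
    {φ : ↥(graph2 T) → ℝ} {φ' : ↥(graph2 T') → ℝ}
    (h : ∀ x y, ext2 T φ (x, y) = ext2 T' φ' (y, x)) (n : ℕ) (E : Set (Fin (n + 1) → X)) :
    orbSum T' φ' n ((· ∘ Fin.rev) '' E) = orbSum T φ n E := by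
  unfold orbSum
  rw [tsum_image (fun x => ENNReal.ofReal (Real.exp (birkhoff T' φ' x)))
    (Fin.rev_surjective.injective_comp_right.injOn)]
  simp only [birkhoff_comp_rev h]

theorem sepSup_le_of_reverse {X : Type*} [MetricSpace X] {T T' : X → Set X}
    {φ : ↥(graph2 T) → ℝ} {φ' : ↥(graph2 T') → ℝ} (hT : ∀ x y, y ∈ T x → x ∈ T' y)
    (h : ∀ x y, ext2 T φ (x, y) = ext2 T' φ' (y, x)) (n : ℕ) (ε : ℝ) :
    sepSup T φ n ε ≤ sepSup T' φ' n ε := by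
  refine iSup_le fun E => iSup₂_le fun hE hsep => ?_
  rw [← orbSum_image_comp_rev h]
  refine le_iSup_of_le ((· ∘ Fin.rev) '' E) (le_iSup₂_of_le ?_ (eSep_image_comp_rev hsep) le_rfl)
  rintro _ ⟨x, hx, rfl⟩
  exact isFinOrbit_comp_rev hT (hE hx)

theorem isCorrespondence_inverse {X : Type*} [MetricSpace X] {T : X → Set X}
    (hT : IsCorrespondence T) (hsurj : corrImage T Set.univ = Set.univ) :
    IsCorrespondence (fun x => {y | x ∈ T y}) := by
  obtain ⟨-, -, hclosed⟩ := hT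
  refine ⟨fun x => ?_, fun x => ?_, ?_⟩
  · have hx : x ∈ corrImage T Set.univ := by rw [hsurj]; exact Set.mem_univ x
    obtain ⟨y, -, hy⟩ := Set.mem_iUnion₂.1 hx
    exact ⟨y, hy⟩
  · exact hclosed.preimage (f := fun y : X => (y, x)) (by fun_prop)
  · exact hclosed.preimage continuous_swap

/-- If `T` is a correspondence with `T(X) = X`, then `T⁻¹` is again a correspondence
and `P(T,φ) = P(T⁻¹, φ̄)` for every continuous `φ`, where `φ̄(x,y) = φ(y,x)`. -/
theorem pressure_inverse
    {X : Type*} [MetricSpace X] [CompactSpace X]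
    (T : X → Set X) (hT : IsCorrespondence T) (hsurj : corrImage T Set.univ = Set.univ) :
    IsCorrespondence (fun x => {y | x ∈ T y}) ∧
      ∀ φ : ↥(graph2 T) → ℝ, Continuous φ →
        pressure T φ =
          pressure (fun x => {y | x ∈ T y})
            (fun p : ↥(graph2 fun x => {y | x ∈ T y}) => φ ⟨(p.1.2, p.1.1), p.2⟩) := by
  refine ⟨isCorrespondence_inverse hT hsurj, fun φ _ => ?_⟩
  have hext : ∀ x y, ext2 T φ (x, y) = ext2 (fun x => {y | x ∈ T y})
      (fun p : ↥(graph2 fun x => {y | x ∈ T y}) => φ ⟨(p.1.2, p.1.1), p.2⟩) (y, x) :=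
    fun _ _ => rfl
  have hsup := fun (n : ℕ) (ε : ℝ) => le_antisymm (a := sepSup T φ n ε)
    (sepSup_le_of_reverse (T := T) (T' := fun x => {y | x ∈ T y}) (fun _ _ hy => hy) hext n ε)
    (sepSup_le_of_reverse (T' := T) (fun _ _ hy => hy) (fun x y => (hext y x).symm) n ε)
  simp only [pressure, pressSepEps, hsup]

end Corr
end

section
/- Forward images of Borel sets under forward expansive correspondences are Borel: Let T be a forward expansive correspondence on a compact metric space (X,d). Then for every Borel set A ⊆ X, the set T(A) := ∪_{x∈A} T(x) is a Borel subset of X. -/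
open Filter MeasureTheory Set
open scoped Topology ENNReal Classical

namespace Corr

/-- Every point is the initial point of an orbit. -/
lemma exists_orbit_from {X : Type*} {T : X → Set X} (hT : ∀ x, (T x).Nonempty) (y : X) :
    ∃ z ∈ orbitSpace T, z 0 = y := by
  choose f hf using hT
  refine ⟨fun n => f^[n] y, fun k => ?_, rfl⟩
  simp only [Function.iterate_succ_apply']
  exact hf _

/-- Prepending to an orbit a point whose image contains the initial point gives an orbit. -/
lemma cons_mem_orbitSpace {X : Type*} {T : X → Set X} {x : X} {z : ℕ → X}
    (hz : z ∈ orbitSpace T) (hx : z 0 ∈ T x) :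
    (fun n => Nat.casesOn n x z : ℕ → X) ∈ orbitSpace T := by
  rintro (_ | k)
  · exact hx
  · exact hz k

/-- Distinct points with a common image point are at distance greater than the
expansive constant. -/
lemma IsFwdExpansiveWith.lt_dist {X : Type*} [MetricSpace X] {T : X → Set X} {ε : ℝ}
    (hexp : IsFwdExpansiveWith T ε) (hT : ∀ x, (T x).Nonempty) {x x' y : X}
    (hx : y ∈ T x) (hx' : y ∈ T x') (hne : x ≠ x') : ε < dist x x' := by
  obtain ⟨z, hz, rfl⟩ := exists_orbit_from hT y
  obtain ⟨n, hn⟩ := hexp.2 _ (cons_mem_orbitSpace hz hx) _ (cons_mem_orbitSpace hz hx')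
    fun h => hne (congrFun h 0)
  cases n with
  | zero => exact hn
  | succ k =>
    simp only [dist_self] at hn
    exact absurd hn hexp.1.not_gt

/-- The forward image is the second projection of the part of the graph over the set. -/
lemma corrImage_eq_image_snd {X : Type*} (T : X → Set X) (A : Set X) :
    corrImage T A = Prod.snd '' (graph2 T ∩ Prod.fst ⁻¹' A) := by
  ext y
  simp [corrImage, graph2, and_comm]

/-- Forward images of Borel sets under a forward expansive correspondence are Borel. -/
theorem image_borel_of_forward_expansive
    {X : Type*} [MetricSpace X] [CompactSpace X] [MeasurableSpace X] [BorelSpace X]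
    (T : X → Set X) (hT : IsCorrespondence T) (hexp : IsFwdExpansive T) :
    ∀ A : Set X, MeasurableSet A → MeasurableSet (corrImage T A) := by
  intro A hA
  obtain ⟨ε, hε⟩ := hexp
  obtain ⟨t, -, ht, hcover⟩ :=
    finite_cover_balls_of_compact (isCompact_univ (X := X)) (half_pos hε.1)
  have hsplit : corrImage T A = ⋃ c ∈ t, corrImage T (A ∩ Metric.ball c (ε / 2)) := by
    ext y
    simp only [corrImage, mem_iUnion, mem_inter_iff, exists_prop]
    constructor
    · rintro ⟨x, hx, hy⟩
      obtain ⟨c, hc, hxc⟩ := mem_iUnion₂.1 (hcover (mem_univ x))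
      exact ⟨c, hc, x, ⟨hx, hxc⟩, hy⟩
    · rintro ⟨c, -, x, ⟨hx, -⟩, hy⟩
      exact ⟨x, hx, hy⟩
  rw [hsplit]
  refine ht.measurableSet_biUnion fun c _ => ?_
  rw [corrImage_eq_image_snd]
  have hgraph : MeasurableSet (graph2 T) := IsClosed.measurableSet hT.2.2
  refine (hgraph.inter (measurable_fst (hA.inter measurableSet_ball)))
    |>.image_of_continuousOn_injOn continuous_snd.continuousOn ?_
  rintro ⟨x, y⟩ ⟨hx, -, hxc⟩ ⟨x', y'⟩ ⟨hx', -, hxc'⟩ (rfl : y = y')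
  by_contra hne
  have hlt := hε.lt_dist hT.1 hx hx' fun h => hne (Prod.ext h rfl)
  have htri := dist_triangle_right x x' c
  have := Metric.mem_ball.1 hxc
  have := Metric.mem_ball.1 hxc'
  linarith

end Corr
end

section
/- Forward images of Borel sets under forward expansive continuous maps are Borel: Let (X,d) be a compact metric space and f : X → X a continuous forward expansive map, i.e., there exists ε > 0 such that for every pair of distinct points x, y ∈ X there is n ∈ ℕ₀ with d(fⁿ(x), fⁿ(y)) > ε. Then f(A) is a Borel subset of X for every Borel set A ⊆ X. -/
open Filter MeasureTheory Set
open scoped Topology ENNReal Classical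

namespace Corr

/-- A continuous map from a Polish space that is injective on each member of a countable Borel
cover sends Borel sets to measurable sets. -/
theorem measurableSet_image_of_countable_cover_injOn {X Y ι : Type*} [TopologicalSpace X]
    [PolishSpace X] [MeasurableSpace X] [BorelSpace X] [TopologicalSpace Y] [T2Space Y]
    [MeasurableSpace Y] [OpensMeasurableSpace Y] {f : X → Y}
    (hf : Continuous f) {t : Set ι} (ht : t.Countable) {B : ι → Set X}
    (hB : ∀ i ∈ t, MeasurableSet (B i)) (hinj : ∀ i ∈ t, InjOn f (B i))
    (hcov : ⋃ i ∈ t, B i = univ) {A : Set X} (hA : MeasurableSet A) :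
    MeasurableSet (f '' A) := by
  have hA' : f '' A = ⋃ i ∈ t, f '' (A ∩ B i) := by
    rw [← image_iUnion₂, ← inter_iUnion₂, hcov, inter_univ]
  rw [hA']
  exact MeasurableSet.biUnion ht fun i hi =>
    (hA.inter (hB i hi)).image_of_continuousOn_injOn hf.continuousOn
      ((hinj i hi).mono inter_subset_right)

/-- Distinct points with the same image under a forward expansive map are far apart. -/
theorem lt_dist_of_apply_eq {X : Type*} [PseudoMetricSpace X] {f : X → X} {ε : ℝ} (hε : 0 < ε)
    (hexp : ∀ x y : X, x ≠ y → ∃ n : ℕ, ε < dist (f^[n] x) (f^[n] y)) {x y : X} (hxy : x ≠ y)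
    (hfxy : f x = f y) : ε < dist x y := by
  obtain ⟨_ | n, hn⟩ := hexp x y hxy
  · exact hn
  · rw [Function.iterate_succ_apply, Function.iterate_succ_apply, hfxy, dist_self] at hn
    exact absurd hn hε.not_gt

/-- Forward images of Borel sets under a continuous forward expansive map are Borel. -/
theorem image_borel_of_forward_expansive_map
    {X : Type*} [MetricSpace X] [CompactSpace X] [MeasurableSpace X] [BorelSpace X]
    (f : X → X) (hf : Continuous f)
    (hexp : ∃ ε : ℝ, 0 < ε ∧ ∀ x y : X, x ≠ y → ∃ n : ℕ, ε < dist (f^[n] x) (f^[n] y)) :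
    ∀ A : Set X, MeasurableSet A → MeasurableSet (f '' A) := by
  obtain ⟨ε, hε, hexp⟩ := hexp
  intro A hA
  obtain ⟨t, -, htfin, hcov⟩ :=
    finite_cover_balls_of_compact (isCompact_univ (X := X)) (half_pos hε)
  refine measurableSet_image_of_countable_cover_injOn hf htfin.countable
    (fun _ _ => measurableSet_ball) (fun c _ x hx y hy hxy => ?_) (univ_subset_iff.1 hcov) hA
  by_contra hne
  have hlt := lt_dist_of_apply_eq hε hexp hne hxy
  have htri := dist_triangle_right x y c
  rw [Metric.mem_ball] at hx hy
  linarith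

end Corr
end

section
/- Uniform contraction of orbit distances near the beginning of long shadowing orbits: Let T be a forward expansive correspondence on a compact metric space (X,d), and let ε₁ > 0 and ε₂ > 0 both be expansive constants of T. Then there exists L ∈ ℕ with the following property: for every n ∈ ℕ with n > L, if two orbits (x₁,…,x_n), (y₁,…,y_n) ∈ O_n(T) satisfy d(x_k,y_k) < ε₂ for all 1 ≤ k ≤ n, then d(x_k,y_k) < ε₁ holds for all 1 ≤ k ≤ n−L. -/
open Filter MeasureTheory Set
open scoped Topology ENNReal Classical

namespace Corr

/-- The pairs of sequences whose first `m` entries form `δ`-close orbits starting at distance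
at least `ε`. -/
def closeSegPairs [MetricSpace X] (T : X → Set X) (ε δ : ℝ) (m : ℕ) :
    Set ((ℕ → X) × (ℕ → X)) :=
  {p | IsOrbitSeg T m p.1 ∧ IsOrbitSeg T m p.2 ∧
    (∀ k < m, dist (p.1 k) (p.2 k) ≤ δ) ∧ ε ≤ dist (p.1 0) (p.2 0)}

theorem antitone_closeSegPairs [MetricSpace X] (T : X → Set X) (ε δ : ℝ) :
    Antitone (closeSegPairs T ε δ) := by
  rintro m n hmn p ⟨hx, hy, hd, h0⟩
  exact ⟨fun i hi => hx i (hi.trans_le hmn), fun i hi => hy i (hi.trans_le hmn),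
    fun k hk => hd k (hk.trans_le hmn), h0⟩

theorem isClosed_setOf_isOrbitSeg [MetricSpace X] {T : X → Set X} (hT : IsCorrespondence T)
    (m : ℕ) : IsClosed {x : ℕ → X | IsOrbitSeg T m x} := by
  simp only [IsOrbitSeg, ofPred_forall]
  refine isClosed_iInter fun i => isClosed_iInter fun _ => ?_
  have hcont : Continuous fun x : ℕ → X => (x i, x (i + 1)) := by fun_prop
  exact hT.2.2.preimage hcont

theorem isClosed_closeSegPairs [MetricSpace X] {T : X → Set X} (hT : IsCorrespondence T)
    (ε δ : ℝ) (m : ℕ) : IsClosed (closeSegPairs T ε δ m) := by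
  have hdist (k : ℕ) : Continuous fun p : (ℕ → X) × (ℕ → X) => dist (p.1 k) (p.2 k) := by
    fun_prop
  have hclose : IsClosed {p : (ℕ → X) × (ℕ → X) | ∀ k < m, dist (p.1 k) (p.2 k) ≤ δ} := by
    simp only [ofPred_forall]
    exact isClosed_iInter fun k => isClosed_iInter fun _ =>
      isClosed_le (hdist k) continuous_const
  exact ((isClosed_setOf_isOrbitSeg hT m).preimage continuous_fst).inter
    (((isClosed_setOf_isOrbitSeg hT m).preimage continuous_snd).inter
      (hclose.inter (isClosed_le continuous_const (hdist 0))))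

theorem exists_closeSegPairs_eq_empty [MetricSpace X] [CompactSpace X] {T : X → Set X}
    (hT : IsCorrespondence T) {ε δ : ℝ} (hε : 0 < ε) (hδ : IsFwdExpansiveWith T δ) :
    ∃ m, closeSegPairs T ε δ m = ∅ := by
  by_contra! hne
  obtain ⟨⟨x, y⟩, hxy⟩ := IsCompact.nonempty_iInter_of_sequence_nonempty_isCompact_isClosed
    (closeSegPairs T ε δ) (fun m => antitone_closeSegPairs T ε δ m.le_succ) hne
    (isClosed_closeSegPairs hT ε δ 0).isCompact (isClosed_closeSegPairs hT ε δ)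
  rw [mem_iInter] at hxy
  have hxy_ne : x ≠ y := by
    rintro rfl
    have h0 : ε ≤ dist (x 0) (x 0) := (hxy 0).2.2.2
    rw [dist_self] at h0
    exact h0.not_gt hε
  obtain ⟨n, hn⟩ := hδ.2 x (fun k => (hxy (k + 2)).1 k (by omega))
    y (fun k => (hxy (k + 2)).2.1 k (by omega)) hxy_ne
  exact ((hxy (n + 1)).2.2.1 n n.lt_succ_self).not_gt hn

/-- Uniform contraction near the beginning of long shadowing orbits: if `ε₁, ε₂` are
both expansive constants of `T`, there is `L` such that for every `n > L`, any two
orbits in `O_n(T)` that stay `ε₂`-close along all `n` entries are `ε₁`-close along the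
first `n - L` entries. -/
theorem orbit_shadowing_contraction
    {X : Type*} [MetricSpace X] [CompactSpace X]
    (T : X → Set X) (hT : IsCorrespondence T) {ε₁ ε₂ : ℝ}
    (h1 : IsFwdExpansiveWith T ε₁) (h2 : IsFwdExpansiveWith T ε₂) :
    ∃ L : ℕ, ∀ n : ℕ, L < n → ∀ x y : ℕ → X, IsOrbitSeg T n x → IsOrbitSeg T n y →
      (∀ k < n, dist (x k) (y k) < ε₂) → ∀ k < n - L, dist (x k) (y k) < ε₁ := by
  obtain ⟨L, hL⟩ := exists_closeSegPairs_eq_empty hT h1.1 h2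
  refine ⟨L, fun n _ x y hx hy hd k hk => ?_⟩
  by_contra! hfar
  have hmem : ((fun i => x (k + i), fun i => y (k + i)) : (ℕ → X) × (ℕ → X)) ∈
      closeSegPairs T ε₁ ε₂ L :=
    ⟨fun i hi => hx (k + i) (by omega), fun i hi => hy (k + i) (by omega),
      fun i hi => (hd (k + i) (by omega)).le, hfar⟩
  simp [hL] at hmem

end Corr
end
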